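/- For every constant integer k ≥ 1, if K_n → ∞, K_n²/P_n → 0, and the edge probability satisfies p_{e,q}(n) = (ln n + (k−1)·ln ln n + α_n)/n for a real sequence α_n converging to a finite limit α* ∈ ℝ, then the probability that the minimum degree δ_n of 𝔾_q(n,K_n,P_n,p_n) is at least k converges, as n → ∞, to exp(−e^{−α*}/(k−1)!). -/

import Mathlib

open Finset Filter

/-- A configuration of the random graph `𝔾_q(n,K,P,p)`: a key-ring assignment
(one finite subset of the key pool `Fin P` per vertex) together with the
on/off states of the channels (one Boolean per unordered pair of vertices). -/
abbrev Config (n P : ℕ) : Type := (Fin n → Finset (Fin P)) × (Sym2 (Fin n) → Bool)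

/-- Probability weight of a configuration: the key rings are independent and
uniform over the `K`-element subsets of the pool of size `P`, and the channels
are independent Bernoulli(`p`). -/
noncomputable def weight (n K P : ℕ) (p : ℝ) (ω : Config n P) : ℝ :=
  (∏ i : Fin n, if (ω.1 i).card = K then ((P.choose K : ℝ))⁻¹ else 0) *
  (∏ e : Sym2 (Fin n), if ω.2 e then p else 1 - p)

/-- Probability of an event in `𝔾_q(n,K,P,p)`. -/
noncomputable def prob (n K P : ℕ) (p : ℝ) (E : Set (Config n P)) : ℝ :=
  ∑ ω : Config n P, Set.indicator E (weight n K P p) ω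

/-- Adjacency in `𝔾_q(n,K,P,p)`: two distinct vertices are adjacent iff their
key rings share at least `q` keys and the channel between them is on. -/
def Adj (q n P : ℕ) (ω : Config n P) (i j : Fin n) : Prop :=
  i ≠ j ∧ q ≤ ((ω.1 i) ∩ (ω.1 j)).card ∧ ω.2 s(i, j) = true

/-- Degree of a vertex. -/
noncomputable def degree (q n P : ℕ) (ω : Config n P) (i : Fin n) : ℕ :=
  Nat.card {j : Fin n // Adj q n P ω i j}

/-- Minimum degree of the graph. -/
noncomputable def minDeg (q n P : ℕ) (ω : Config n P) : ℕ :=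
  sInf (Set.range fun i => degree q n P ω i)

/-- `p_{s,q}`: the probability that two key rings share at least `q` keys. -/
noncomputable def psq (q K P : ℕ) : ℝ :=
  1 - ∑ u ∈ Finset.range q,
    ((K.choose u : ℝ) * ((P - K).choose (K - u) : ℝ)) / (P.choose K : ℝ)

/-- `p_{e,q}`: the probability that two distinct vertices are adjacent. -/
noncomputable def peq (q K P : ℕ) (p : ℝ) : ℝ := p * psq q K P

theorem abs_indicator_sub_alternating_sum_choose_le (X M : ℕ) :
    |(if X = 0 then (1 : ℝ) else 0) - ∑ j ∈ range M, (-1 : ℝ) ^ j * (X.choose j : ℝ)|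
      ≤ (X.choose M : ℝ) := by
  cases X with
  | zero =>
    cases M with
    | zero => simp
    | succ M => simp [Finset.sum_range_succ']
  | succ X =>
    have key : ∀ M, ∑ j ∈ range (M + 1), (-1 : ℝ) ^ j * ((X + 1).choose j : ℝ)
        = (-1) ^ M * (X.choose M : ℝ) := by
      intro M
      induction M with
      | zero => simp
      | succ M ih =>
        rw [Finset.sum_range_succ, ih, Nat.choose_succ_succ]
        push_cast
        ring
    cases M with
    | zero => simp
    | succ M =>
      rw [key]
      simp only [Nat.add_eq_zero_iff, one_ne_zero, and_false, if_false, zero_sub, abs_neg,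
        abs_mul, abs_pow, abs_one, one_pow, one_mul, Nat.abs_cast]
      exact_mod_cast (Nat.choose_succ_succ X M) ▸ Nat.le_add_right _ _

/-- If the binomial moments `B j n` of a count converge to those of a Poisson variable of mean
`c`, then the probability that the count vanishes converges to `exp (-c)`. -/
theorem tendsto_exp_neg_of_binomial_moments (Q : ℕ → ℝ) (B : ℕ → ℕ → ℝ) (c : ℝ)
    (hQ : ∀ M, ∀ᶠ n in atTop, |Q n - ∑ j ∈ range M, (-1 : ℝ) ^ j * B j n| ≤ B M n)
    (hB : ∀ j, Tendsto (B j) atTop (nhds (c ^ j / (j.factorial : ℝ)))) :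
    Tendsto Q atTop (nhds (Real.exp (-c))) := by
  have hsum : Tendsto (fun M => ∑ j ∈ range M, (-1 : ℝ) ^ j * (c ^ j / (j.factorial : ℝ)))
      atTop (nhds (Real.exp (-c))) := by
    have h := (NormedSpace.expSeries_div_hasSum_exp (-c)).tendsto_sum_nat
    rw [← Real.exp_eq_exp_ℝ] at h
    refine h.congr fun M => Finset.sum_congr rfl fun j _ => ?_
    rw [neg_pow]
    ring
  have hzero : Tendsto (fun M : ℕ => c ^ M / (M.factorial : ℝ)) atTop (nhds 0) :=
    FloorSemiring.tendsto_pow_div_factorial_atTop c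
  rw [Metric.tendsto_nhds]
  intro ε hε
  have h1 := (Metric.tendsto_nhds.1 hsum) (ε / 4) (by positivity)
  have h2 := (Metric.tendsto_nhds.1 hzero) (ε / 4) (by positivity)
  obtain ⟨M, hM1, hM2⟩ := (h1.and h2).exists
  have h3 : Tendsto (fun n => ∑ j ∈ range M, (-1 : ℝ) ^ j * B j n) atTop
      (nhds (∑ j ∈ range M, (-1 : ℝ) ^ j * (c ^ j / (j.factorial : ℝ)))) :=
    tendsto_finsetSum _ fun j _ => (hB j).const_mul _
  filter_upwards [hQ M, (Metric.tendsto_nhds.1 h3) (ε / 4) (by positivity),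
    (Metric.tendsto_nhds.1 (hB M)) (ε / 4) (by positivity)] with n hn1 hn2 hn3
  rw [Real.dist_eq, abs_lt] at *
  rw [abs_le] at hn1
  constructor <;> linarith [hM1.1, hM1.2, hM2.1, hM2.2, hn2.1, hn2.2, hn3.1, hn3.2, hn1.1, hn1.2]

section Patterns

variable {a b : Type*} [Fintype a] [DecidableEq a] [Fintype b] [DecidableEq b]

/-- The total mass, under the product weight `∏ v, π (f v)`, of the patterns `f : b → Finset a`
in which every `i : a` occurs at most `r` times. -/
noncomputable def patternSum (b : Type*) [Fintype b] [DecidableEq b] (π : Finset a → ℝ) (r : ℕ) :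
    ℝ :=
  ∑ f : b → Finset a with ∀ i, #{v | i ∈ f v} ≤ r, ∏ v, π (f v)

/-- Transposition of incidence patterns. -/
def patternEquiv (a b : Type*) [Fintype a] [DecidableEq a] [Fintype b] [DecidableEq b] :
    (b → Finset a) ≃ (a → Finset b) where
  toFun f i := {v | i ∈ f v}
  invFun T v := {i | v ∈ T i}
  left_inv f := by ext v i; simp
  right_inv T := by ext i v; simp

theorem card_ne_empty_le (f : b → Finset a) (r : ℕ) (hf : ∀ i, #{v | i ∈ f v} ≤ r) :
    #{v | f v ≠ ∅} ≤ Fintype.card a * r := by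
  have hsub : ({v | f v ≠ ∅} : Finset b) ⊆ univ.biUnion fun i => {v | i ∈ f v} := by
    intro v hv
    obtain ⟨i, hi⟩ := Finset.nonempty_iff_ne_empty.2 (Finset.mem_filter.1 hv).2
    simp only [mem_biUnion, mem_filter, mem_univ, true_and]
    exact ⟨i, hi⟩
  exact (card_le_card hsub).trans (card_biUnion_le_card_mul _ _ _ fun i _ => hf i)

omit [DecidableEq b] in
theorem prod_eq_of_card_le_one (π : Finset a → ℝ) (f : b → Finset a) (hf : ∀ v, #(f v) ≤ 1) :
    ∏ v, π (f v) = (∏ i, π {i} ^ #{v | i ∈ f v}) * π ∅ ^ #{v | f v = ∅} := by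
  have h1 : ∀ v, π (f v) = (∏ i ∈ f v, π {i}) * if f v = ∅ then π ∅ else 1 := by
    intro v
    rcases Nat.le_one_iff_eq_zero_or_eq_one.1 (hf v) with h | h
    · rw [card_eq_zero] at h
      simp [h]
    · obtain ⟨i, hi⟩ := card_eq_one.1 h
      simp [hi]
  rw [prod_congr rfl fun v _ => h1 v, prod_mul_distrib]
  congr 1
  · rw [prod_comm' (t' := univ) (s' := fun i => {v | i ∈ f v}) (by simp)]
    simp
  · rw [prod_ite]
    simp

omit [DecidableEq a] in
theorem sum_pi_prod (g : Finset a → ℝ) :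
    ∑ f : b → Finset a, ∏ v, g (f v) = (∑ t, g t) ^ Fintype.card b := by
  rw [← Fintype.prod_sum fun (_ : b) t => g t]
  simp

theorem add_mul_one_sub_eq_sum (π : Finset a → ℝ) (h1 : ∑ t, π t = 1) (x : ℝ) :
    π ∅ + x * (1 - π ∅) = ∑ t, (if t = ∅ then 1 else x) * π t := by
  have h2 := Finset.add_sum_erase _ π (mem_univ (∅ : Finset a))
  rw [← Finset.add_sum_erase _ _ (mem_univ (∅ : Finset a)), if_pos rfl, one_mul, ← h1, ← h2,
    add_sub_cancel_left, Finset.mul_sum]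
  congr 1
  refine sum_congr rfl fun t ht => ?_
  rw [if_neg (ne_of_mem_erase ht)]

/-- Exponential Markov bound for `patternSum`. -/
theorem patternSum_le_exponential (π : Finset a → ℝ) (h0 : ∀ t, 0 ≤ π t) (h1 : ∑ t, π t = 1)
    (r : ℕ) (x : ℝ) (hx : 0 < x) (hx1 : x ≤ 1) :
    patternSum b π r ≤ (x ^ (Fintype.card a * r))⁻¹ *
      (π ∅ + x * (1 - π ∅)) ^ Fintype.card b := by
  rw [add_mul_one_sub_eq_sum π h1, ← sum_pi_prod, Finset.mul_sum, patternSum]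
  refine (Finset.sum_le_sum fun f hf => ?_).trans
    (Finset.sum_le_sum_of_subset_of_nonneg (Finset.subset_univ _) fun f _ _ => ?_)
  · rw [prod_mul_distrib, ← mul_assoc]
    refine le_mul_of_one_le_left (prod_nonneg fun v _ => h0 _) ?_
    rw [prod_ite, prod_const_one, one_mul, prod_const, ← div_eq_inv_mul, one_le_div (by positivity)]
    exact pow_le_pow_of_le_one hx.le hx1 (card_ne_empty_le f r (mem_filter.1 hf).2)
  · refine mul_nonneg (by positivity) (prod_nonneg fun v _ => mul_nonneg ?_ (h0 _))
    split_ifs <;> linarith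

theorem patternSum_le_of_card_le_one (π : Finset a → ℝ) (h0 : ∀ t, 0 ≤ π t) (h1 : ∑ t, π t = 1)
    (r : ℕ) (x z y : ℝ) (hx : 0 < x) (hx1 : x ≤ 1) (hz : 1 ≤ z) (hy : ∀ i, π {i} ≤ y) :
    patternSum b π r ≤
      π ∅ ^ (Fintype.card b - Fintype.card a * r) *
        (∑ j ∈ range (r + 1), ((Fintype.card b).choose j : ℝ) * y ^ j) ^ Fintype.card a +
      (x ^ (Fintype.card a * r))⁻¹ * z⁻¹ *
        (π ∅ + x * (1 - π ∅) + z * ∑ t with 1 < #t, π t) ^ Fintype.card b := by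
  have hle1 : π ∅ ≤ 1 := by
    rw [← h1]
    exact single_le_sum (fun t _ => h0 t) (mem_univ _)
  rw [patternSum, ← Finset.sum_filter_add_sum_filter_not _ fun f : b → Finset a => ∀ v, #(f v) ≤ 1,
    filter_filter, filter_filter]
  refine add_le_add ?_ ?_
  · have h3 : (∑ j ∈ range (r + 1), ((Fintype.card b).choose j : ℝ) * y ^ j) ^ Fintype.card a
        = ∑ T : a → Finset b with ∀ i, #(T i) ≤ r, ∏ i, y ^ #(T i) := by
      have h4 : ∑ t : Finset b with #t ≤ r, y ^ #t
          = ∑ j ∈ range (r + 1), ((Fintype.card b).choose j : ℝ) * y ^ j := by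
        rw [← sum_fiberwise_of_maps_to (t := range (r + 1)) (g := fun t : Finset b => #t)
          (by simp)]
        refine sum_congr rfl fun j hj => ?_
        rw [filter_filter, sum_congr rfl (g := fun _ => y ^ j) (by
          intro t ht
          rw [(mem_filter.1 ht).2.2])]
        rw [sum_const, nsmul_eq_mul]
        congr 2
        rw [← Finset.card_univ, ← card_powersetCard]
        congr 1
        ext t
        simp only [mem_filter, mem_univ, true_and, mem_powersetCard, subset_univ]
        have := mem_range.1 hj
        omega
      rw [← h4, ← Finset.card_univ, ← prod_const, prod_univ_sum]
      refine sum_congr ?_ fun _ _ => rfl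
      ext T
      simp
    rw [h3, Finset.mul_sum]
    have h5 : ∀ f ∈ ({f : b → Finset a | (∀ i, #{v | i ∈ f v} ≤ r) ∧ ∀ v, #(f v) ≤ 1} :
        Finset (b → Finset a)), ∏ v, π (f v) ≤
          π ∅ ^ (Fintype.card b - Fintype.card a * r) * ∏ i, y ^ #(patternEquiv a b f i) := by
      intro f hf
      obtain ⟨hf1, hf2⟩ := (mem_filter.1 hf).2
      rw [prod_eq_of_card_le_one π f hf2, mul_comm]
      refine mul_le_mul ?_ ?_ (prod_nonneg fun i _ => pow_nonneg (h0 _) _) (pow_nonneg (h0 _) _)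
      · refine pow_le_pow_of_le_one (h0 _) hle1 ?_
        have := card_ne_empty_le f r hf1
        have h6 := card_filter_add_card_filter_not (s := (univ : Finset b)) fun v => f v = ∅
        rw [Finset.card_univ] at h6
        simp only [ne_eq] at this
        omega
      · exact prod_le_prod (fun i _ => pow_nonneg (h0 _) _)
          fun i _ => pow_le_pow_left₀ (h0 _) (hy i) _
    refine (sum_le_sum h5).trans ?_
    rw [sum_equiv (patternEquiv a b) (t := {T : a → Finset b | (∀ i, #(T i) ≤ r) ∧
        ∀ v, #((patternEquiv a b).symm T v) ≤ 1})
        (g := fun T => π ∅ ^ (Fintype.card b - Fintype.card a * r) * ∏ i, y ^ #(T i))]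
    · refine sum_le_sum_of_subset_of_nonneg ?_ ?_
      · intro T
        simp only [mem_filter, mem_univ, true_and]
        exact fun h => h.1
      · intro T _ _
        refine mul_nonneg (pow_nonneg (h0 _) _) (prod_nonneg fun i _ => pow_nonneg ?_ _)
        exact (h0 _).trans (hy i)
    · intro f
      simp only [mem_filter, mem_univ, true_and, Equiv.symm_apply_apply]
      rfl
    · intro f _
      rfl
  · have hterm : ∀ t, 0 ≤ ((if t = ∅ then 1 else x) + if 1 < #t then z else 0) * π t := by
      intro t
      refine mul_nonneg (add_nonneg ?_ ?_) (h0 _) <;> split_ifs <;> linarith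
    have h2 : π ∅ + x * (1 - π ∅) + z * ∑ t with 1 < #t, π t
        = ∑ t, ((if t = ∅ then 1 else x) + if 1 < #t then z else 0) * π t := by
      rw [add_mul_one_sub_eq_sum π h1]
      simp only [add_mul, sum_add_distrib, Finset.mul_sum, sum_filter, ite_mul, zero_mul, mul_ite,
        mul_zero]
    rw [h2, ← sum_pi_prod, Finset.mul_sum]
    refine (Finset.sum_le_sum fun f hf => ?_).trans
      (Finset.sum_le_sum_of_subset_of_nonneg (Finset.subset_univ _) fun f _ _ => ?_)
    · obtain ⟨hf1, hf2⟩ := (mem_filter.1 hf).2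
      push Not at hf2
      obtain ⟨v₀, hv₀⟩ := hf2
      rw [prod_mul_distrib, ← mul_assoc]
      refine le_mul_of_one_le_left (prod_nonneg fun v _ => h0 _) ?_
      rw [← mul_inv, ← div_eq_inv_mul, one_le_div (by positivity)]
      have hfac : ∀ v, (if f v = ∅ then 1 else x) * (if v = v₀ then z else 1)
          ≤ (if f v = ∅ then 1 else x) + if 1 < #(f v) then z else 0 := by
        intro v
        by_cases hv : v = v₀
        · subst hv
          have : f v ≠ ∅ := by
            rintro h
            simp [h] at hv₀
          rw [if_neg this, if_pos rfl, if_pos hv₀]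
          nlinarith
        · rw [if_neg hv, mul_one]
          refine le_add_of_nonneg_right ?_
          split_ifs <;> linarith
      refine le_trans ?_ (prod_le_prod (fun v _ => ?_) fun v _ => hfac v)
      · rw [prod_mul_distrib]
        simp only [prod_ite_eq', mem_univ, if_true]
        refine mul_le_mul_of_nonneg_right ?_ (by linarith)
        rw [prod_ite, prod_const_one, one_mul, prod_const]
        exact pow_le_pow_of_le_one hx.le hx1 (card_ne_empty_le f r hf1)
      · refine mul_nonneg ?_ ?_ <;> split_ifs <;> linarith
    · exact mul_nonneg (by positivity) (prod_nonneg fun v _ => hterm _)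

theorem pow_choose_le_card_disjoint_aux (r : ℕ) (s : Finset a) :
    ((Fintype.card b - Fintype.card a * r).choose r) ^ #s ≤
      #{T : a → Finset b | (∀ i ∈ s, #(T i) = r) ∧ (∀ i ∉ s, T i = ∅) ∧
        ∀ i j, i ≠ j → Disjoint (T i) (T j)} := by
  induction s using Finset.induction with
  | empty =>
    rw [card_empty, pow_zero]
    refine card_pos.2 ⟨fun _ => ∅, ?_⟩
    simp
  | insert i s hi ih =>
    rw [card_insert_of_notMem hi, pow_succ]
    set D : Finset (a → Finset b) := {T | (∀ i ∈ s, #(T i) = r) ∧ (∀ i ∉ s, T i = ∅) ∧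
        ∀ i j, i ≠ j → Disjoint (T i) (T j)}
    have hD : ∀ T ∈ D, (∀ i ∈ s, #(T i) = r) ∧ (∀ i ∉ s, T i = ∅) ∧
        ∀ i j, i ≠ j → Disjoint (T i) (T j) := fun T hT => (mem_filter.1 hT).2
    have h1 : #D * (Fintype.card b - Fintype.card a * r).choose r
        ≤ #(D.sigma fun T => powersetCard r (univ \ s.biUnion T)) := by
      rw [card_sigma, ← smul_eq_mul, ← sum_const]
      refine sum_le_sum fun T hT => ?_
      rw [card_powersetCard]
      refine Nat.choose_le_choose _ ?_
      rw [card_sdiff_of_subset (subset_univ _), Finset.card_univ]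
      have h2 : #(s.biUnion T) ≤ #s * r :=
        card_biUnion_le_card_mul _ _ _ fun j hj => ((hD T hT).1 j hj).le
      have h3 : #s * r ≤ Fintype.card a * r := Nat.mul_le_mul_right _ (card_le_univ s)
      omega
    refine (Nat.mul_le_mul_right _ ih).trans (h1.trans ?_)
    refine card_le_card_of_injOn (fun x => Function.update x.1 i x.2) ?_ ?_
    · rintro ⟨T, B⟩ hx
      obtain ⟨hT, hB⟩ := mem_sigma.1 (mem_coe.1 hx)
      obtain ⟨hT1, hT2, hT3⟩ := hD T hT
      obtain ⟨hB1, hB2⟩ := mem_powersetCard.1 hB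
      have hdis : ∀ j, j ≠ i → Disjoint B (T j) := by
        intro j hj
        by_cases hjs : j ∈ s
        · exact disjoint_of_subset_left hB1
            (disjoint_of_subset_right (subset_biUnion_of_mem T hjs) sdiff_disjoint)
        · rw [hT2 j hjs]
          exact disjoint_empty_right _
      refine mem_coe.2 (mem_filter.2 ⟨mem_univ _, ?_, ?_, ?_⟩)
      · intro j hj
        by_cases hji : j = i
        · subst hji
          simpa using hB2
        · simp only [Function.update_of_ne hji]
          exact hT1 j (mem_of_mem_insert_of_ne hj hji)
      · intro j hj
        rw [mem_insert, not_or] at hj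
        simp only [Function.update_of_ne hj.1]
        exact hT2 j hj.2
      · intro j l hjl
        by_cases hji : j = i
        · subst hji
          simpa [Function.update_of_ne hjl.symm] using hdis l hjl.symm
        · by_cases hli : l = i
          · subst hli
            simpa [Function.update_of_ne hji] using (hdis j hji).symm
          · simpa [Function.update_of_ne hji, Function.update_of_ne hli] using hT3 j l hjl
    · rintro ⟨T, B⟩ hx ⟨T', B'⟩ hx' h
      have hT := (hD T (mem_sigma.1 (mem_coe.1 hx)).1).2.1 i hi
      have hT' := (hD T' (mem_sigma.1 (mem_coe.1 hx')).1).2.1 i hi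
      simp only at h
      have hB : B = B' := by simpa using congrFun h i
      have hTT : T = T' := by
        funext j
        by_cases hj : j = i
        · subst hj
          rw [hT, hT']
        · simpa [Function.update_of_ne hj] using congrFun h j
      subst hB hTT
      rfl

theorem le_patternSum (π : Finset a → ℝ) (h0 : ∀ t, 0 ≤ π t) (h1 : ∑ t, π t = 1)
    (r : ℕ) (y : ℝ) (hy0 : 0 ≤ y) (hy : ∀ i, y ≤ π {i}) :
    (((Fintype.card b - Fintype.card a * r).choose r : ℝ) * y ^ r) ^ Fintype.card a *
      π ∅ ^ Fintype.card b ≤ patternSum b π r := by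
  have hle1 : π ∅ ≤ 1 := by
    rw [← h1]
    exact single_le_sum (fun t _ => h0 t) (mem_univ _)
  set D : Finset (a → Finset b) := {T | (∀ i ∈ (univ : Finset a), #(T i) = r) ∧
    (∀ i ∉ (univ : Finset a), T i = ∅) ∧ ∀ i j, i ≠ j → Disjoint (T i) (T j)} with hDdef
  have hcard : (((Fintype.card b - Fintype.card a * r).choose r : ℝ)) ^ Fintype.card a ≤ #D := by
    have := pow_choose_le_card_disjoint_aux (b := b) r (univ : Finset a)
    rw [Finset.card_univ] at this
    exact_mod_cast this
  have hterm : ∀ T ∈ D, y ^ (r * Fintype.card a) * π ∅ ^ Fintype.card b ≤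
      ∏ v, π ((patternEquiv a b).symm T v) := by
    intro T hT
    obtain ⟨hT1, -, hT3⟩ := (mem_filter.1 hT).2
    have hle : ∀ v, #((patternEquiv a b).symm T v) ≤ 1 := by
      intro v
      refine card_le_one.2 fun i hi j hj => ?_
      have hi' : v ∈ T i := by simpa [patternEquiv] using hi
      have hj' : v ∈ T j := by simpa [patternEquiv] using hj
      by_contra hij
      exact disjoint_left.1 (hT3 i j hij) hi' hj'
    rw [prod_eq_of_card_le_one π _ hle]
    refine mul_le_mul ?_ ?_ (pow_nonneg (h0 _) _) (prod_nonneg fun i _ => pow_nonneg (h0 _) _)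
    · have h3 : ∀ i, #{v | i ∈ (patternEquiv a b).symm T v} = r := by
        intro i
        rw [← hT1 i (mem_univ i)]
        congr 1
        ext v
        simp [patternEquiv]
      rw [pow_mul, ← Finset.card_univ, ← prod_const]
      refine prod_le_prod (fun i _ => by positivity) fun i _ => ?_
      rw [h3]
      exact pow_le_pow_left₀ hy0 (hy i) _
    · exact pow_le_pow_of_le_one (h0 _) hle1 (card_le_univ _)
  calc _ = (((Fintype.card b - Fintype.card a * r).choose r : ℝ)) ^ Fintype.card a *
        (y ^ (r * Fintype.card a) * π ∅ ^ Fintype.card b) := by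
        rw [mul_pow, ← pow_mul]
        ring
    _ ≤ #D * (y ^ (r * Fintype.card a) * π ∅ ^ Fintype.card b) :=
        mul_le_mul_of_nonneg_right hcard
          (mul_nonneg (by positivity) (pow_nonneg (h0 _) _))
    _ = ∑ T ∈ D, y ^ (r * Fintype.card a) * π ∅ ^ Fintype.card b := by
        rw [sum_const, nsmul_eq_mul]
    _ ≤ ∑ T ∈ D, ∏ v, π ((patternEquiv a b).symm T v) := sum_le_sum hterm
    _ = ∑ f ∈ D.map (patternEquiv a b).symm.toEmbedding, ∏ v, π (f v) := by
        rw [sum_map]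
        rfl
    _ ≤ _ := by
        refine sum_le_sum_of_subset_of_nonneg ?_ fun f _ _ => prod_nonneg fun v _ => h0 _
        intro f hf
        obtain ⟨T, hT, rfl⟩ := mem_map.1 hf
        refine mem_filter.2 ⟨mem_univ _, fun i => ?_⟩
        rw [← (mem_filter.1 hT).2.1 i (mem_univ i)]
        refine card_le_card fun v hv => ?_
        simpa [patternEquiv] using hv

end Patterns

/-- Probability weight of a single key ring. -/
noncomputable def ringWeight (K P : ℕ) (R : Finset (Fin P)) : ℝ :=
  if R.card = K then ((P.choose K : ℝ))⁻¹ else 0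

/-- Probability that two vertices with key rings `S` and `R` are adjacent. -/
noncomputable def linkProb (q P : ℕ) (p : ℝ) (S R : Finset (Fin P)) : ℝ :=
  if q ≤ #(S ∩ R) then p else 0

/-- Probability that, given the key rings `S i` of the vertices `i : a`, a further vertex is
adjacent to exactly the vertices in `t`. -/
noncomputable def nbrProb {a : Type*} [Fintype a] [DecidableEq a] (q K P : ℕ) (p : ℝ)
    (S : a → Finset (Fin P)) (t : Finset a) : ℝ :=
  ∑ R, ringWeight K P R *
    ∏ i, if i ∈ t then linkProb q P p (S i) R else 1 - linkProb q P p (S i) R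

/-- Expectation over the configurations of `𝔾_q(n,K,P,p)`. -/
noncomputable def expectation (n K P : ℕ) (p : ℝ) (f : Config n P → ℝ) : ℝ :=
  ∑ ω : Config n P, weight n K P p ω * f ω

/-- For every vertex outside `A`, the set of its neighbours in `A`. -/
def outerPattern (q n P : ℕ) (A : Finset (Fin n)) (ω : Config n P) (v : {v // v ∉ A}) :
    Finset {i // i ∈ A} :=
  {i | q ≤ #(ω.1 i ∩ ω.1 v) ∧ ω.2 s(i, v) = true}

theorem sum_bool_functions_prod {ι E : Type*} [Fintype ι] [Fintype E] [DecidableEq E]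
    (h : ι → E) (hh : Function.Injective h) (w : Bool → ℝ) (hw : ∑ b, w b = 1)
    (g : ι → Bool → ℝ) :
    ∑ c : E → Bool, (∏ e, w (c e)) * ∏ x, g x (c (h x)) = ∏ x, ∑ b, w b * g x b := by
  classical
  have h1 : ∀ c : E → Bool, ∏ x, g x (c (h x)) = ∏ e, ∏ x with h x = e, g x (c e) := by
    intro c
    rw [← prod_fiberwise_of_maps_to (g := h) (t := univ) (fun _ _ => mem_univ _)]
    refine prod_congr rfl fun e _ => prod_congr rfl fun x hx => ?_
    rw [(mem_filter.1 hx).2]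
  simp only [h1, ← prod_mul_distrib]
  rw [← Fintype.prod_sum fun e b => w b * ∏ x with h x = e, g x b]
  symm
  refine Fintype.prod_of_injective h hh _ _ (fun e he => ?_) fun x => ?_
  · have : ({x | h x = e} : Finset ι) = ∅ := by
      ext x
      simp only [mem_filter, mem_univ, true_and, notMem_empty, iff_false]
      exact fun hx => he ⟨x, hx⟩
    simpa [this] using hw
  · have : ({y | h y = h x} : Finset ι) = {x} := by
      ext y
      simp [hh.eq_iff]
    simp [this]

theorem sum_pi_prod_subtype {n : ℕ} {ρ : Type*} [Fintype ρ] (A : Finset (Fin n)) (w : ρ → ℝ)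
    (φ : ({i // i ∈ A} → ρ) → ℝ) (H : ({i // i ∈ A} → ρ) → {v // v ∉ A} → ρ → ℝ) :
    ∑ S : Fin n → ρ, (∏ i, w (S i)) * (φ (fun i => S i) * ∏ v, H (fun i => S i) v (S v))
      = ∑ S : {i // i ∈ A} → ρ, (∏ i, w (S i)) * (φ S * ∏ v, ∑ R, w R * H S v R) := by
  classical
  rw [Fintype.sum_equiv (Equiv.piEquivPiSubtypeProd (fun i => i ∈ A) fun _ => ρ) _
    (fun x => ((∏ i, w (x.1 i)) * ∏ v, w (x.2 v)) * (φ x.1 * ∏ v, H x.1 v (x.2 v)))]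
  · rw [Fintype.sum_prod_type]
    refine sum_congr rfl fun S _ => ?_
    rw [Fintype.prod_sum, mul_sum, mul_sum]
    refine sum_congr rfl fun T _ => ?_
    rw [prod_mul_distrib]
    ring
  · intro S
    congr 1
    rw [← Fintype.prod_subtype_mul_prod_subtype (fun i => i ∈ A)]
    simp only [Equiv.piEquivPiSubtypeProd_apply]
    congr!

theorem expectation_mul_outerPattern_eq (q n K P : ℕ) (p : ℝ) (A : Finset (Fin n))
    (φ : ({i // i ∈ A} → Finset (Fin P)) → ℝ) (f : {v // v ∉ A} → Finset {i // i ∈ A}) :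
    expectation n K P p (fun ω => φ (fun i => ω.1 i) * if outerPattern q n P A ω = f then 1 else 0)
      = ∑ S : {i // i ∈ A} → Finset (Fin P), (∏ i, ringWeight K P (S i)) *
          (φ S * ∏ v, nbrProb q K P p S (f v)) := by
  classical
  set g : (Fin n → Finset (Fin P)) → {i // i ∈ A} × {v // v ∉ A} → Bool → ℝ := fun S x b =>
    if (x.1 ∈ f x.2 ↔ q ≤ #(S x.1 ∩ S x.2) ∧ b = true) then 1 else 0 with hg
  set w : Bool → ℝ := fun b => if b then p else 1 - p with hw
  have hw1 : ∑ b, w b = 1 := by simp [hw]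
  have hinj : Function.Injective fun x : {i // i ∈ A} × {v // v ∉ A} =>
      (s((x.1 : Fin n), (x.2 : Fin n)) : Sym2 (Fin n)) := by
    rintro ⟨⟨i, hi⟩, ⟨v, hv⟩⟩ ⟨⟨i', hi'⟩, ⟨v', hv'⟩⟩ h
    simp only [Sym2.eq_iff] at h
    rcases h with ⟨h1, h2⟩ | ⟨h1, h2⟩
    · subst h1 h2
      rfl
    · subst h1
      exact absurd hi hv'
  have hind : ∀ ω : Config n P, (if outerPattern q n P A ω = f then (1 : ℝ) else 0)
      = ∏ x, g ω.1 x (ω.2 s((x.1 : Fin n), (x.2 : Fin n))) := by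
    intro ω
    rw [hg]
    simp only [prod_boole, mem_univ, true_imp_iff]
    congr 1
    rw [eq_iff_iff, funext_iff]
    constructor
    · rintro h ⟨i, v⟩
      simp [← h v, outerPattern]
    · intro h v
      ext i
      rw [(h (i, v))]
      simp [outerPattern]
  have hlocal : ∀ (S : Fin n → Finset (Fin P)) (x : {i // i ∈ A} × {v // v ∉ A}),
      ∑ b, w b * g S x b = if x.1 ∈ f x.2 then linkProb q P p (S x.1) (S x.2)
        else 1 - linkProb q P p (S x.1) (S x.2) := by
    intro S x
    simp only [hg, hw, Fintype.sum_bool, linkProb]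
    by_cases h1 : x.1 ∈ f x.2 <;> by_cases h2 : q ≤ #(S x.1 ∩ S x.2) <;> simp [h1, h2]
  rw [expectation, Fintype.sum_prod_type]
  have hstep : ∀ S : Fin n → Finset (Fin P),
      ∑ c : Sym2 (Fin n) → Bool, weight n K P p (S, c) *
        (φ (fun i => S i) * if outerPattern q n P A (S, c) = f then 1 else 0)
      = (∏ i, ringWeight K P (S i)) * (φ (fun i => S i) *
          ∏ v, ∏ i, if i ∈ f v then linkProb q P p (S i) (S v)
            else 1 - linkProb q P p (S i) (S v)) := by
    intro S
    have h1 := sum_bool_functions_prod _ hinj w hw1 (g S)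
    simp only [hlocal, Fintype.prod_prod_type_right] at h1
    rw [← h1, mul_sum, mul_sum]
    refine sum_congr rfl fun c _ => ?_
    rw [hind, Fintype.prod_prod_type_right, weight]
    simp only [ringWeight, hw]
    ring
  rw [sum_congr rfl fun S _ => hstep S]
  exact sum_pi_prod_subtype A (ringWeight K P) φ fun S v R =>
    ∏ i, if i ∈ f v then linkProb q P p (S i) R else 1 - linkProb q P p (S i) R

theorem ringWeight_nonneg (K P : ℕ) (R : Finset (Fin P)) : 0 ≤ ringWeight K P R := by
  unfold ringWeight
  split_ifs <;> positivity

theorem sum_ringWeight_mul (K P : ℕ) (g : Finset (Fin P) → ℝ) :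
    ∑ R, ringWeight K P R * g R = (∑ R ∈ powersetCard K univ, g R) / (P.choose K : ℝ) := by
  have h : (powersetCard K univ : Finset (Finset (Fin P))) = ({R | #R = K} : Finset _) := by
    ext R
    simp
  rw [h, sum_filter, sum_div]
  refine sum_congr rfl fun R _ => ?_
  unfold ringWeight
  split_ifs
  · rw [inv_mul_eq_div]
  · simp

theorem sum_ringWeight {K P : ℕ} (hKP : K ≤ P) : ∑ R, ringWeight K P R = 1 := by
  have h := sum_ringWeight_mul K P fun _ => 1
  simp only [mul_one] at h
  rw [h, sum_const, card_powersetCard, Finset.card_univ, Fintype.card_fin, nsmul_eq_mul, mul_one]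
  exact div_self (Nat.cast_ne_zero.2 (Nat.choose_pos hKP).ne')

theorem weight_nonneg (n K P : ℕ) {p : ℝ} (hp0 : 0 ≤ p) (hp1 : p ≤ 1) (ω : Config n P) :
    0 ≤ weight n K P p ω := by
  unfold weight
  refine mul_nonneg (prod_nonneg fun i _ => ringWeight_nonneg K P _)
    (prod_nonneg fun e _ => ?_)
  split_ifs <;> linarith

theorem expectation_mono {n K P : ℕ} {p : ℝ} (hp0 : 0 ≤ p) (hp1 : p ≤ 1) {f g : Config n P → ℝ}
    (h : ∀ ω, f ω ≤ g ω) : expectation n K P p f ≤ expectation n K P p g :=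
  sum_le_sum fun ω _ => mul_le_mul_of_nonneg_left (h ω) (weight_nonneg n K P hp0 hp1 ω)

theorem prob_eq_expectation (n K P : ℕ) (p : ℝ) (E : Config n P → Prop)
    [DecidablePred E] :
    prob n K P p {ω | E ω} = expectation n K P p fun ω => if E ω then 1 else 0 := by
  unfold prob expectation
  refine sum_congr rfl fun ω _ => ?_
  classical
  rw [Set.indicator_apply]
  simp [Set.mem_ofPred_eq]

theorem expectation_mul_admissible (q n K P : ℕ) (p : ℝ) (A : Finset (Fin n)) (r : ℕ)
    (φ : ({i // i ∈ A} → Finset (Fin P)) → ℝ) :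
    expectation n K P p (fun ω => φ (fun i => ω.1 i) *
        if ∀ i, #{v | i ∈ outerPattern q n P A ω v} ≤ r then 1 else 0)
      = ∑ S : {i // i ∈ A} → Finset (Fin P), (∏ i, ringWeight K P (S i)) *
          (φ S * patternSum {v // v ∉ A} (nbrProb q K P p S) r) := by
  have h1 : ∀ ω : Config n P,
      (if ∀ i, #{v | i ∈ outerPattern q n P A ω v} ≤ r then (1 : ℝ) else 0)
      = ∑ f : {v // v ∉ A} → Finset {i // i ∈ A} with ∀ i, #{v | i ∈ f v} ≤ r,
          if outerPattern q n P A ω = f then 1 else 0 := by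
    intro ω
    rw [sum_ite_eq]
    simp
  simp only [h1, mul_sum]
  unfold expectation
  simp only [mul_sum]
  rw [sum_comm]
  have h2 := fun f => expectation_mul_outerPattern_eq q n K P p A φ f
  simp only [expectation] at h2
  rw [sum_congr rfl fun f _ => h2 f, sum_comm]
  refine sum_congr rfl fun S _ => ?_
  rw [patternSum, mul_sum, mul_sum]

theorem card_outerPattern_le_degree (q n P : ℕ) (A : Finset (Fin n)) (ω : Config n P)
    (i : {i // i ∈ A}) : #{v | i ∈ outerPattern q n P A ω v} ≤ degree q n P ω i := by
  classical
  rw [degree, Nat.card_eq_fintype_card, Fintype.card_subtype]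
  refine card_le_card_of_injOn (fun v => (v : Fin n)) ?_ Subtype.val_injective.injOn
  intro v hv
  have h1 := (mem_filter.1 (mem_coe.1 hv)).2
  simp only [outerPattern, mem_filter, mem_univ, true_and] at h1
  refine mem_coe.2 (mem_filter.2 ⟨mem_univ _, ?_, h1⟩)
  intro h
  have h2 : (i : Fin n) = v := h
  exact v.2 (h2 ▸ i.2)

theorem degree_le_card_outerPattern {q : ℕ} (hq : 1 ≤ q) (n P : ℕ) (A : Finset (Fin n))
    (ω : Config n P) (h : ∀ i j : {i // i ∈ A}, i ≠ j → Disjoint (ω.1 i) (ω.1 j))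
    (i : {i // i ∈ A}) : degree q n P ω i ≤ #{v | i ∈ outerPattern q n P A ω v} := by
  classical
  rw [degree, Nat.card_eq_fintype_card, Fintype.card_subtype]
  have hA : ∀ j, Adj q n P ω i j → j ∉ A := by
    rintro j ⟨hij, hcard, -⟩ hj
    have := h i ⟨j, hj⟩ fun h => hij (congrArg Subtype.val h)
    rw [disjoint_iff_inter_eq_empty] at this
    simp only [this, card_empty] at hcard
    omega
  refine card_le_card_of_surjOn (fun v : {v // v ∉ A} => (v : Fin n)) ?_
  intro j hj
  have hj' := (mem_filter.1 (mem_coe.1 hj)).2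
  refine ⟨⟨j, hA j hj'⟩, ?_, rfl⟩
  simp only [coe_filter, mem_univ, true_and, Set.mem_ofPred_eq, outerPattern, mem_filter]
  exact hj'.2

theorem prob_degree_le_le (q n K P : ℕ) {p : ℝ} (hp0 : 0 ≤ p) (hp1 : p ≤ 1) (A : Finset (Fin n))
    (r : ℕ) :
    prob n K P p {ω | ∀ i ∈ A, degree q n P ω i ≤ r} ≤
      ∑ S : {i // i ∈ A} → Finset (Fin P), (∏ i, ringWeight K P (S i)) *
        patternSum {v // v ∉ A} (nbrProb q K P p S) r := by
  classical
  have h := expectation_mul_admissible q n K P p A r fun _ => 1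
  simp only [one_mul] at h
  rw [← h, prob_eq_expectation]
  refine expectation_mono hp0 hp1 fun ω => ?_
  by_cases h1 : ∀ i ∈ A, degree q n P ω i ≤ r
  · rw [if_pos h1, if_pos fun i => (card_outerPattern_le_degree q n P A ω i).trans (h1 i i.2)]
  · rw [if_neg (by simpa using h1)]
    split_ifs <;> norm_num

theorem le_prob_degree_le {q : ℕ} (hq : 1 ≤ q) (n K P : ℕ) {p : ℝ} (hp0 : 0 ≤ p) (hp1 : p ≤ 1)
    (A : Finset (Fin n)) (r : ℕ) :
    ∑ S : {i // i ∈ A} → Finset (Fin P), (∏ i, ringWeight K P (S i)) *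
        ((if ∀ i j, i ≠ j → Disjoint (S i) (S j) then 1 else 0) *
          patternSum {v // v ∉ A} (nbrProb q K P p S) r) ≤
      prob n K P p {ω | ∀ i ∈ A, degree q n P ω i ≤ r} := by
  classical
  rw [← expectation_mul_admissible q n K P p A r fun S =>
    if ∀ i j, i ≠ j → Disjoint (S i) (S j) then 1 else 0, prob_eq_expectation]
  refine expectation_mono hp0 hp1 fun ω => ?_
  by_cases h1 : ∀ i j : {i // i ∈ A}, i ≠ j → Disjoint (ω.1 i) (ω.1 j)
  · by_cases h2 : ∀ i, #{v | i ∈ outerPattern q n P A ω v} ≤ r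
    · rw [if_pos h1, if_pos h2, if_pos, mul_one]
      intro i hi
      exact (degree_le_card_outerPattern hq n P A ω h1 ⟨i, hi⟩).trans (h2 ⟨i, hi⟩)
    · rw [if_neg h2, mul_zero]
      split_ifs <;> norm_num
  · rw [if_neg h1, zero_mul]
    split_ifs <;> norm_num

theorem abs_prob_minDeg_sub_le (q : ℕ) {n K P : ℕ} (hn : 0 < n) {p : ℝ} (hp0 : 0 ≤ p)
    (hp1 : p ≤ 1) (r M : ℕ) :
    |prob n K P p {ω | r + 1 ≤ minDeg q n P ω} - ∑ j ∈ range M, (-1 : ℝ) ^ j *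
        ∑ A ∈ powersetCard j univ, prob n K P p {ω | ∀ i ∈ A, degree q n P ω i ≤ r}|
      ≤ ∑ A ∈ powersetCard M univ, prob n K P p {ω | ∀ i ∈ A, degree q n P ω i ≤ r} := by
  classical
  have hchoose : ∀ j, ∑ A ∈ powersetCard j (univ : Finset (Fin n)),
      prob n K P p {ω | ∀ i ∈ A, degree q n P ω i ≤ r}
      = expectation n K P p fun ω => ((#{i | degree q n P ω i ≤ r}).choose j : ℝ) := by
    intro j
    simp only [prob_eq_expectation]
    unfold expectation
    rw [sum_comm]
    refine sum_congr rfl fun ω _ => ?_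
    rw [← mul_sum]
    refine congrArg _ ((sum_boole _ _).trans ?_)
    beta_reduce
    rw [← card_powersetCard]
    congr 2
    ext A
    simp only [mem_filter, mem_powersetCard, true_and, Finset.subset_iff, mem_univ]
    tauto
  have hzero : prob n K P p {ω | r + 1 ≤ minDeg q n P ω}
      = expectation n K P p fun ω => if #{i | degree q n P ω i ≤ r} = 0 then 1 else 0 := by
    rw [prob_eq_expectation]
    congr 1
    funext ω
    congr 1
    rw [eq_iff_iff, card_eq_zero, filter_eq_empty_iff]
    have : Nonempty (Fin n) := ⟨⟨0, hn⟩⟩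
    constructor
    · intro h i _
      have h1 : minDeg q n P ω ≤ degree q n P ω i := Nat.sInf_le ⟨i, rfl⟩
      have h2 : r + 1 ≤ minDeg q n P ω := h
      omega
    · intro h
      refine le_csInf (α := ℕ) (Set.range_nonempty _) ?_
      rintro _ ⟨i, rfl⟩
      have := h (mem_univ i)
      change r + 1 ≤ degree q n P ω i
      omega
  simp only [hchoose, hzero]
  unfold expectation
  simp only [mul_sum]
  rw [sum_comm, ← sum_sub_distrib]
  refine (abs_sum_le_sum_abs _ _).trans (sum_le_sum fun ω _ => ?_)
  have h1 := abs_indicator_sub_alternating_sum_choose_le (#{i | degree q n P ω i ≤ r}) M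
  refine le_trans (le_of_eq ?_) (mul_le_mul_of_nonneg_left h1 (weight_nonneg n K P hp0 hp1 ω))
  rw [← abs_of_nonneg (weight_nonneg n K P hp0 hp1 ω), ← abs_mul,
    abs_of_nonneg (weight_nonneg n K P hp0 hp1 ω), mul_sub, mul_sum]
  congr 2
  refine sum_congr rfl fun j _ => ?_
  ring

section Rings

variable {K P : ℕ}

theorem choose_div_choose_le_pow (hKP : K ≤ P) (m : ℕ) :
    (K.choose m : ℝ) / (P.choose m : ℝ) ≤ ((K : ℝ) / P) ^ m := by
  rcases Nat.lt_or_ge P m with hm | hm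
  · rw [Nat.choose_eq_zero_of_lt hm, Nat.cast_zero, div_zero]
    positivity
  have h1 : ∀ m, K.descFactorial m * P ^ m ≤ P.descFactorial m * K ^ m := by
    intro m
    induction m with
    | zero => simp
    | succ m ih =>
      rw [Nat.descFactorial_succ, Nat.descFactorial_succ, pow_succ, pow_succ]
      have h2 : (K - m) * P ≤ (P - m) * K := by
        rw [Nat.sub_mul, Nat.sub_mul, Nat.mul_comm P K]
        exact Nat.sub_le_sub_left (Nat.mul_le_mul_left _ hKP) _
      calc (K - m) * K.descFactorial m * (P ^ m * P)
          = (K.descFactorial m * P ^ m) * ((K - m) * P) := by ring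
        _ ≤ (P.descFactorial m * K ^ m) * ((P - m) * K) := Nat.mul_le_mul ih h2
        _ = _ := by ring
  have hP : 0 < (P.choose m : ℝ) := Nat.cast_pos.2 (Nat.choose_pos hm)
  rcases Nat.eq_zero_or_pos P with h0 | h0
  · subst h0
    obtain rfl : m = 0 := by omega
    simp
  rw [div_pow, div_le_div_iff₀ hP (by positivity)]
  have h3 := h1 m
  rw [Nat.descFactorial_eq_factorial_mul_choose, Nat.descFactorial_eq_factorial_mul_choose,
    mul_assoc, mul_assoc] at h3
  have h4 := Nat.le_of_mul_le_mul_left h3 m.factorial_pos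
  rw [mul_comm ((K : ℝ) ^ m)]
  exact_mod_cast h4

theorem sum_ringWeight_subset (hKP : K ≤ P) (B : Finset (Fin P)) :
    ∑ R, ringWeight K P R * (if B ⊆ R then 1 else 0)
      = (K.choose #B : ℝ) / (P.choose #B : ℝ) := by
  have hBP : #B ≤ P := by simpa using card_le_univ B
  rw [sum_ringWeight_mul, sum_boole]
  rcases Nat.lt_or_ge K #B with h | h
  · rw [Nat.choose_eq_zero_of_lt h, filter_false_of_mem]
    · simp
    · intro R hR hB
      have := card_le_card hB
      rw [(mem_powersetCard.1 hR).2] at this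
      omega
  · rw [card_filter_powersetCard_subset _ _ _ (subset_univ _) h, Finset.card_univ,
      Fintype.card_fin]
    have h1 : 0 < (P.choose K : ℝ) := Nat.cast_pos.2 (Nat.choose_pos hKP)
    have h2 : 0 < (P.choose #B : ℝ) := Nat.cast_pos.2 (Nat.choose_pos hBP)
    rw [div_eq_div_iff h1.ne' h2.ne']
    have := Nat.choose_mul (n := P) h
    rw [mul_comm, mul_comm (K.choose #B : ℝ)]
    exact_mod_cast this.symm

theorem sum_ringWeight_subset_le (hKP : K ≤ P) (B : Finset (Fin P)) :
    ∑ R, ringWeight K P R * (if B ⊆ R then 1 else 0) ≤ ((K : ℝ) / P) ^ #B :=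
  (sum_ringWeight_subset hKP B).le.trans (choose_div_choose_le_pow hKP _)

theorem card_filter_card_inter_eq {S : Finset (Fin P)} (hS : #S = K) {u : ℕ} (hu : u ≤ K) :
    #{R ∈ powersetCard K (univ : Finset (Fin P)) | #(S ∩ R) = u}
      = K.choose u * (P - K).choose (K - u) := by
  have h1 : K.choose u * (P - K).choose (K - u)
      = #(powersetCard u S ×ˢ powersetCard (K - u) Sᶜ) := by
    rw [card_product, card_powersetCard, card_powersetCard, card_compl, hS, Fintype.card_fin]
  rw [h1]
  refine card_bij' (fun R _ => (S ∩ R, R \ S)) (fun x _ => x.1 ∪ x.2) ?_ ?_ ?_ ?_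
  · intro R hR
    obtain ⟨hR1, hR2⟩ := mem_filter.1 hR
    have hR3 := (mem_powersetCard.1 hR1).2
    refine mem_product.2 ⟨mem_powersetCard.2 ⟨inter_subset_left, hR2⟩, mem_powersetCard.2 ⟨?_, ?_⟩⟩
    · intro x hx
      simpa using (mem_sdiff.1 hx).2
    · have := card_sdiff_add_card_inter R S
      rw [inter_comm] at this
      simp only
      omega
  · rintro ⟨B, C⟩ hx
    obtain ⟨hB, hC⟩ := mem_product.1 hx
    obtain ⟨hB1, hB2⟩ := mem_powersetCard.1 hB
    obtain ⟨hC1, hC2⟩ := mem_powersetCard.1 hC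
    have hdis : Disjoint S C := disjoint_left.2 fun x hx hx' => by
      simpa [hx] using hC1 hx'
    refine mem_filter.2 ⟨mem_powersetCard.2 ⟨subset_univ _, ?_⟩, ?_⟩
    · simp only at hB2 hC2 ⊢
      rw [card_union_of_disjoint (disjoint_of_subset_left hB1 hdis), hB2, hC2]
      omega
    · simp only at hB2 hB1 ⊢
      rw [inter_union_distrib_left, inter_eq_right.2 hB1, disjoint_iff_inter_eq_empty.1 hdis,
        union_empty, hB2]
  · intro R _
    simp only
    rw [inter_comm, union_comm, sdiff_union_inter]
  · rintro ⟨B, C⟩ hx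
    obtain ⟨hB, hC⟩ := mem_product.1 hx
    obtain ⟨hB1, hB2⟩ := mem_powersetCard.1 hB
    obtain ⟨hC1, hC2⟩ := mem_powersetCard.1 hC
    simp only at hB1 hC1 ⊢
    have hdis : Disjoint S C := disjoint_left.2 fun x hx hx' => by
      simpa [hx] using hC1 hx'
    rw [Prod.mk.injEq]
    constructor
    · rw [inter_union_distrib_left, inter_eq_right.2 hB1, disjoint_iff_inter_eq_empty.1 hdis,
        union_empty]
    · rw [union_sdiff_distrib, sdiff_eq_empty_iff_subset.2 hB1, empty_union,
        sdiff_eq_self_of_disjoint hdis.symm]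

theorem sum_ringWeight_linkProb (hKP : K ≤ P) (q : ℕ) (p : ℝ) {S : Finset (Fin P)}
    (hS : #S = K) : ∑ R, ringWeight K P R * linkProb q P p S R = peq q K P p := by
  have h1 : ∀ R, linkProb q P p S R
      = p * (1 - ∑ u ∈ range q, if #(S ∩ R) = u then 1 else 0) := by
    intro R
    rw [sum_ite_eq, linkProb]
    by_cases h : q ≤ #(S ∩ R)
    · rw [if_pos h, if_neg (by simpa using h)]
      ring
    · rw [if_neg h, if_pos (by simpa using h)]
      ring
  have h2 : ∀ u, ∑ R, ringWeight K P R * (if #(S ∩ R) = u then 1 else 0)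
      = (K.choose u : ℝ) * ((P - K).choose (K - u) : ℝ) / (P.choose K : ℝ) := by
    intro u
    rw [sum_ringWeight_mul, sum_boole]
    rcases Nat.lt_or_ge K u with hu | hu
    · rw [Nat.choose_eq_zero_of_lt hu, filter_false_of_mem]
      · simp
      · intro R _ hR
        have := card_le_card (inter_subset_left (s₁ := S) (s₂ := R))
        omega
    · rw [card_filter_card_inter_eq hS hu]
      push_cast
      rfl
  simp only [h1, peq, psq]
  simp only [← h2]
  rw [sum_comm]
  simp only [← mul_sum]
  rw [← sum_ringWeight hKP, ← sum_sub_distrib, mul_sum]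
  refine sum_congr rfl fun R _ => ?_
  rw [sum_ringWeight hKP]
  ring

theorem sum_ringWeight_choose (hKP : K ≤ P) {S : Finset (Fin P)} (hS : #S = K) (m : ℕ) :
    ∑ R, ringWeight K P R * ((#(S ∩ R)).choose m : ℝ)
      = (K.choose m : ℝ) * ((K.choose m : ℝ) / (P.choose m : ℝ)) := by
  have h1 : ∀ R : Finset (Fin P), ((#(S ∩ R)).choose m : ℝ)
      = ∑ B ∈ powersetCard m S, if B ⊆ R then 1 else 0 := by
    intro R
    rw [sum_boole, ← card_powersetCard]
    congr 2
    ext B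
    simp only [mem_powersetCard, mem_filter, subset_inter_iff]
    tauto
  simp only [h1, mul_sum]
  rw [sum_comm, sum_congr rfl fun B hB => (sum_ringWeight_subset hKP B).trans (by
    rw [(mem_powersetCard.1 hB).2])]
  rw [sum_const, card_powersetCard, hS, nsmul_eq_mul]

theorem choose_sub_mul_choose_succ_le {q : ℕ} (hq : 1 ≤ q) (X : ℕ) :
    (X.choose q : ℝ) - q * (X.choose (q + 1) : ℝ) ≤ if q ≤ X then 1 else 0 := by
  split_ifs with h
  · have h1 : (X.choose (q + 1) : ℝ) * (q + 1) = X.choose q * ((X : ℝ) - q) := by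
      have := Nat.choose_succ_right_eq X q
      rw [← Nat.cast_sub h]
      exact_mod_cast this
    obtain ⟨d, rfl⟩ := Nat.exists_eq_add_of_le h
    rcases d with _ | _ | d
    · simp
    · rw [show q + (0 + 1) = q + 1 by ring, Nat.choose_self, Nat.choose_succ_self_right]
      push_cast
      linarith
    · have hq' : (1 : ℝ) ≤ q := by exact_mod_cast hq
      have h2 : (0 : ℝ) ≤ (q + (d + 1 + 1)).choose q := Nat.cast_nonneg _
      push_cast at h1
      have h3 : ((q + (d + 1 + 1)).choose q : ℝ) * (1 * (q + 1)) ≤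
          q * (((q + (d + 1 + 1)).choose (q + 1) : ℝ) * (q + 1)) := by
        rw [h1]
        have h4 : (1 : ℝ) * (q + 1) ≤ q * (q + (d + 1 + 1) - q) := by
          nlinarith [mul_nonneg (Nat.cast_nonneg (α := ℝ) q) (Nat.cast_nonneg (α := ℝ) d)]
        calc _ ≤ ((q + (d + 1 + 1)).choose q : ℝ) * (q * (q + (d + 1 + 1) - q)) :=
              mul_le_mul_of_nonneg_left h4 h2
          _ = _ := by ring
      rw [one_mul, ← mul_assoc] at h3
      have := le_of_mul_le_mul_right h3 (by positivity)
      linarith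
  · rw [Nat.choose_eq_zero_of_lt (by omega), Nat.choose_eq_zero_of_lt (by omega)]
    simp

theorem le_psq {q : ℕ} (hq : 1 ≤ q) (hKP : K ≤ P) (hqK : 2 * q ≤ K)
    (hκ : (K : ℝ) ^ 2 / P ≤ 1 / 2) :
    ((K : ℝ) ^ 2 / P) ^ q / (2 * 4 ^ q * q.factorial) ≤ psq q K P := by
  have hK : (0 : ℝ) < K := by
    have : 0 < K := by omega
    exact_mod_cast this
  have hP : (0 : ℝ) < P := by
    have : 0 < P := by omega
    exact_mod_cast this
  have hKP' : (K : ℝ) ≤ P := by exact_mod_cast hKP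
  have hqK' : 2 * (q : ℝ) ≤ K := by exact_mod_cast hqK
  have hq' : (1 : ℝ) ≤ q := by exact_mod_cast hq
  obtain ⟨S, -, hS⟩ := exists_subset_card_eq (s := (univ : Finset (Fin P))) (n := K) (by simpa)
  have h1 := sum_ringWeight_linkProb hKP q 1 hS
  rw [peq, one_mul] at h1
  have h2 : (K.choose q : ℝ) * ((K.choose q : ℝ) / (P.choose q : ℝ)) -
      q * ((K.choose (q + 1) : ℝ) * ((K.choose (q + 1) : ℝ) / (P.choose (q + 1) : ℝ)))
      ≤ psq q K P := by
    rw [← h1, ← sum_ringWeight_choose hKP hS, ← sum_ringWeight_choose hKP hS, mul_sum,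
      ← sum_sub_distrib]
    refine sum_le_sum fun R _ => ?_
    have := mul_le_mul_of_nonneg_left (choose_sub_mul_choose_succ_le hq #(S ∩ R))
      (ringWeight_nonneg K P R)
    rw [linkProb]
    linarith
  have hPq : 0 < (P.choose q : ℝ) := Nat.cast_pos.2 (Nat.choose_pos (by omega))
  set c : ℝ := (K.choose q : ℝ) * ((K.choose q : ℝ) / (P.choose q : ℝ)) with hc
  have hc0 : 0 ≤ c := by positivity
  have h3 : q * ((K.choose (q + 1) : ℝ) * ((K.choose (q + 1) : ℝ) / (P.choose (q + 1) : ℝ)))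
      ≤ c * ((K : ℝ) ^ 2 / P) := by
    have e1 : (K.choose (q + 1) : ℝ) = K.choose q * ((K : ℝ) - q) / (q + 1) := by
      rw [eq_div_iff (by positivity), ← Nat.cast_sub (by omega)]
      exact_mod_cast Nat.choose_succ_right_eq K q
    have e2 : (P.choose (q + 1) : ℝ) = P.choose q * ((P : ℝ) - q) / (q + 1) := by
      rw [eq_div_iff (by positivity), ← Nat.cast_sub (by omega)]
      exact_mod_cast Nat.choose_succ_right_eq P q
    have hPq' : (0 : ℝ) < P - q := by linarith
    have e3 : q * ((K.choose (q + 1) : ℝ) * ((K.choose (q + 1) : ℝ) / (P.choose (q + 1) : ℝ)))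
        = c * ((q / (q + 1)) * (((K : ℝ) - q) ^ 2 / (P - q))) := by
      rw [e1, e2, hc]
      field_simp
    rw [e3]
    refine mul_le_mul_of_nonneg_left ?_ hc0
    have e4 : (q : ℝ) / (q + 1) ≤ 1 := by
      rw [div_le_one (by positivity)]
      linarith
    have e5 : ((K : ℝ) - q) ^ 2 / (P - q) ≤ (K : ℝ) ^ 2 / P := by
      rw [div_le_div_iff₀ hPq' hP]
      have e6 : ((K : ℝ) - q) * P ≤ K * (P - q) := by nlinarith
      have e7 : (K : ℝ) - q ≤ K := by linarith
      calc ((K : ℝ) - q) ^ 2 * P = ((K : ℝ) - q) * (((K : ℝ) - q) * P) := by ring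
        _ ≤ K * (K * (P - q)) := mul_le_mul e7 e6
            (mul_nonneg (by linarith) hP.le) hK.le
        _ = _ := by ring
    calc _ ≤ 1 * ((K : ℝ) ^ 2 / P) :=
          mul_le_mul e4 e5 (div_nonneg (sq_nonneg _) hPq'.le) zero_le_one
      _ = _ := one_mul _
  have h4 : c / 2 ≤ psq q K P := by
    have : c * ((K : ℝ) ^ 2 / P) ≤ c * (1 / 2) := mul_le_mul_of_nonneg_left hκ hc0
    linarith
  refine le_trans ?_ h4
  have h5 : ((K : ℝ) / 2) ^ q / q.factorial ≤ K.choose q := by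
    refine le_trans ?_ (Nat.pow_le_choose q K)
    refine div_le_div_of_nonneg_right (pow_le_pow_left₀ (by positivity) ?_ _) (by positivity)
    rw [Nat.cast_sub (by omega)]
    push_cast
    linarith
  have h6 : (P.choose q : ℝ) ≤ (P : ℝ) ^ q / q.factorial := Nat.choose_le_pow_div q P
  have hf : (0 : ℝ) < q.factorial := by exact_mod_cast q.factorial_pos
  calc ((K : ℝ) ^ 2 / P) ^ q / (2 * 4 ^ q * q.factorial)
      = (((K : ℝ) / 2) ^ q / q.factorial * (((K : ℝ) / 2) ^ q / q.factorial /
          ((P : ℝ) ^ q / q.factorial))) / 2 := by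
        rw [show (4 : ℝ) = 2 * 2 by norm_num, mul_pow, div_pow, div_pow, ← pow_mul, mul_comm 2 q,
          pow_mul, sq]
        field_simp
    _ ≤ c / 2 := by
        rw [hc]
        gcongr

theorem sum_ringWeight_pow_card_inter_le (hKP : K ≤ P) {S : Finset (Fin P)} (hS : #S = K)
    {z : ℝ} (hz : 1 ≤ z) :
    ∑ R, ringWeight K P R * z ^ #(S ∩ R) ≤ Real.exp ((z - 1) * ((K : ℝ) ^ 2 / P)) := by
  have h1 : ∀ R : Finset (Fin P), z ^ #(S ∩ R)
      = ∑ B ∈ S.powerset, (z - 1) ^ #B * if B ⊆ R then 1 else 0 := by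
    intro R
    have h2 := Finset.sum_pow_mul_eq_add_pow (z - 1) 1 (S ∩ R)
    rw [sub_add_cancel] at h2
    rw [← h2]
    simp only [one_pow, mul_one, mul_ite, mul_zero]
    rw [← sum_filter]
    refine sum_congr ?_ fun _ _ => rfl
    ext B
    simp only [mem_powerset, mem_filter, subset_inter_iff]
  simp only [h1, mul_sum]
  rw [sum_comm]
  have h3 : ∀ B ∈ S.powerset, ∑ R, ringWeight K P R * ((z - 1) ^ #B * if B ⊆ R then 1 else 0)
      ≤ ((z - 1) * ((K : ℝ) / P)) ^ #B := by
    intro B _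
    rw [mul_pow]
    refine le_trans (le_of_eq ?_) (mul_le_mul_of_nonneg_left (sum_ringWeight_subset_le hKP B)
      (pow_nonneg (by linarith) _))
    rw [mul_sum]
    exact sum_congr rfl fun R _ => by ring
  refine (sum_le_sum h3).trans ?_
  have h4 := Finset.sum_pow_mul_eq_add_pow ((z - 1) * ((K : ℝ) / P)) 1 S
  simp only [one_pow, mul_one] at h4
  rw [h4, hS]
  have h5 : (z - 1) * ((K : ℝ) ^ 2 / P) = K * ((z - 1) * ((K : ℝ) / P)) := by ring
  rw [h5, Real.exp_nat_mul]
  refine pow_le_pow_left₀ ?_ (Real.add_one_le_exp _) _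
  have : 0 ≤ z - 1 := by linarith
  positivity

/-- Probability that a third vertex is adjacent to both of two vertices with key rings `S`, `T`. -/
noncomputable def jointProb (q K P : ℕ) (p : ℝ) (S T : Finset (Fin P)) : ℝ :=
  ∑ R, ringWeight K P R * (linkProb q P p S R * linkProb q P p T R)

theorem jointProb_le {q : ℕ} (hq : 1 ≤ q) (hK : 0 < K) (hKP : K ≤ P) (p : ℝ)
    {S T : Finset (Fin P)} (hS : #S = K) (hT : #T = K) :
    jointProb q K P p S T ≤ p ^ 2 * ((#(S ∩ T) : ℝ) / K * ((K : ℝ) ^ 2 / P) ^ q +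
      (((K : ℝ) ^ 2 / P) ^ q) ^ 2) := by
  have hpt : ∀ R : Finset (Fin P), linkProb q P p S R * linkProb q P p T R ≤
      p ^ 2 * (∑ x ∈ S ∩ T, ∑ B ∈ powersetCard (q - 1) (S.erase x),
          (if insert x B ⊆ R then (1 : ℝ) else 0) +
        ∑ B ∈ powersetCard q (S \ T), ∑ C ∈ powersetCard q (T \ S),
          if B ∪ C ⊆ R then (1 : ℝ) else 0) := by
    intro R
    have hn1 : 0 ≤ ∑ x ∈ S ∩ T, ∑ B ∈ powersetCard (q - 1) (S.erase x),
          (if insert x B ⊆ R then (1 : ℝ) else 0) :=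
      sum_nonneg fun x _ => sum_nonneg fun B _ => by split_ifs <;> norm_num
    have hn2 : 0 ≤ ∑ B ∈ powersetCard q (S \ T), ∑ C ∈ powersetCard q (T \ S),
          (if B ∪ C ⊆ R then (1 : ℝ) else 0) :=
      sum_nonneg fun x _ => sum_nonneg fun B _ => by split_ifs <;> norm_num
    by_cases h : q ≤ #(S ∩ R) ∧ q ≤ #(T ∩ R)
    · rw [linkProb, linkProb, if_pos h.1, if_pos h.2, ← sq]
      refine le_mul_of_one_le_right (sq_nonneg _) ?_
      by_cases hx : (S ∩ T ∩ R).Nonempty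
      · obtain ⟨x, hx⟩ := hx
        obtain ⟨hxST, hxR⟩ := mem_inter.1 hx
        have hxS := (mem_inter.1 hxST).1
        have h1 : q - 1 ≤ #((S ∩ R).erase x) := by
          rw [card_erase_of_mem (mem_inter.2 ⟨hxS, hxR⟩)]
          omega
        obtain ⟨B, hB1, hB2⟩ := exists_subset_card_eq h1
        have hB3 : B ⊆ S.erase x := hB1.trans (erase_subset_erase _ inter_subset_left)
        have hB4 : insert x B ⊆ R := insert_subset hxR
          (hB1.trans ((erase_subset _ _).trans inter_subset_right))
        have h2 : (1 : ℝ) ≤ ∑ B ∈ powersetCard (q - 1) (S.erase x),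
            (if insert x B ⊆ R then (1 : ℝ) else 0) := by
          refine le_trans ?_ (single_le_sum (f := fun B => if insert x B ⊆ R then (1 : ℝ) else 0)
            (fun B _ => by split_ifs <;> norm_num) (mem_powersetCard.2 ⟨hB3, hB2⟩))
          simp only [if_pos hB4, le_refl]
        have h3 := single_le_sum (f := fun x => ∑ B ∈ powersetCard (q - 1) (S.erase x),
            (if insert x B ⊆ R then (1 : ℝ) else 0))
            (fun x _ => sum_nonneg fun B _ => by split_ifs <;> norm_num) hxST
        linarith
      · rw [not_nonempty_iff_eq_empty] at hx
        have hSR : S ∩ R ⊆ S \ T := by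
          intro x hx1
          obtain ⟨hx2, hx3⟩ := mem_inter.1 hx1
          refine mem_sdiff.2 ⟨hx2, fun hx4 => ?_⟩
          have : x ∈ S ∩ T ∩ R := mem_inter.2 ⟨mem_inter.2 ⟨hx2, hx4⟩, hx3⟩
          simp [hx] at this
        have hTR : T ∩ R ⊆ T \ S := by
          intro x hx1
          obtain ⟨hx2, hx3⟩ := mem_inter.1 hx1
          refine mem_sdiff.2 ⟨hx2, fun hx4 => ?_⟩
          have : x ∈ S ∩ T ∩ R := mem_inter.2 ⟨mem_inter.2 ⟨hx4, hx2⟩, hx3⟩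
          simp [hx] at this
        obtain ⟨B, hB1, hB2⟩ := exists_subset_card_eq h.1
        obtain ⟨C, hC1, hC2⟩ := exists_subset_card_eq h.2
        have hBC : B ∪ C ⊆ R := union_subset (hB1.trans inter_subset_right)
          (hC1.trans inter_subset_right)
        have h2 : (1 : ℝ) ≤ ∑ C ∈ powersetCard q (T \ S), (if B ∪ C ⊆ R then (1 : ℝ) else 0) := by
          refine le_trans ?_ (single_le_sum (f := fun C => if B ∪ C ⊆ R then (1 : ℝ) else 0)
            (fun B _ => by split_ifs <;> norm_num) (mem_powersetCard.2 ⟨hC1.trans hTR, hC2⟩))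
          simp only [if_pos hBC, le_refl]
        have h3 := single_le_sum (f := fun B => ∑ C ∈ powersetCard q (T \ S),
            (if B ∪ C ⊆ R then (1 : ℝ) else 0))
            (fun x _ => sum_nonneg fun B _ => by split_ifs <;> norm_num)
            (mem_powersetCard.2 ⟨hB1.trans hSR, hB2⟩)
        linarith
    · have h0 : linkProb q P p S R * linkProb q P p T R = 0 := by
        rw [not_and_or] at h
        rcases h with h | h
        · rw [linkProb, if_neg h, zero_mul]
        · rw [linkProb, linkProb, if_neg h, mul_zero]
      rw [h0]
      positivity
  have hstep : jointProb q K P p S T ≤ p ^ 2 *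
      (∑ x ∈ S ∩ T, ∑ B ∈ powersetCard (q - 1) (S.erase x),
          ∑ R, ringWeight K P R * (if insert x B ⊆ R then (1 : ℝ) else 0) +
        ∑ B ∈ powersetCard q (S \ T), ∑ C ∈ powersetCard q (T \ S),
          ∑ R, ringWeight K P R * if B ∪ C ⊆ R then (1 : ℝ) else 0) := by
    refine (sum_le_sum fun R _ => mul_le_mul_of_nonneg_left (hpt R)
      (ringWeight_nonneg K P R)).trans (le_of_eq ?_)
    have e : ∀ R : Finset (Fin P), ∀ x y : ℝ, ringWeight K P R * (p ^ 2 * (x + y))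
        = p ^ 2 * (ringWeight K P R * x + ringWeight K P R * y) := fun _ _ _ => by ring
    simp only [e, ← mul_sum, sum_add_distrib]
    congr 2
    · simp only [mul_sum]
      rw [sum_comm]
      exact sum_congr rfl fun x _ => sum_comm
    · simp only [mul_sum]
      rw [sum_comm]
      exact sum_congr rfl fun x _ => sum_comm
  refine hstep.trans (mul_le_mul_of_nonneg_left (add_le_add ?_ ?_) (sq_nonneg _))
  · have h1 : ∀ x ∈ S ∩ T, ∑ B ∈ powersetCard (q - 1) (S.erase x),
        ∑ R, ringWeight K P R * (if insert x B ⊆ R then (1 : ℝ) else 0) ≤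
        (K : ℝ) ^ (q - 1) * ((K : ℝ) / P) ^ q := by
      intro x hx
      have h2 : ∀ B ∈ powersetCard (q - 1) (S.erase x),
          ∑ R, ringWeight K P R * (if insert x B ⊆ R then (1 : ℝ) else 0) ≤
          ((K : ℝ) / P) ^ q := by
        intro B hB
        obtain ⟨hB1, hB2⟩ := mem_powersetCard.1 hB
        have h3 := sum_ringWeight_subset_le hKP (insert x B)
        rw [card_insert_of_notMem fun h => by simpa using hB1 h, hB2, Nat.sub_add_cancel hq] at h3
        exact h3
      refine (sum_le_card_nsmul _ _ _ h2).trans ?_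
      rw [nsmul_eq_mul, card_powersetCard]
      refine mul_le_mul_of_nonneg_right ?_ (by positivity)
      have h4 := Nat.choose_le_pow (#(S.erase x)) (q - 1)
      have h5 : #(S.erase x) ^ (q - 1) ≤ K ^ (q - 1) :=
        Nat.pow_le_pow_left (hS ▸ card_erase_le) _
      exact_mod_cast h4.trans h5
    refine (sum_le_card_nsmul _ _ _ h1).trans (le_of_eq ?_)
    rw [nsmul_eq_mul]
    have hK' : (K : ℝ) ≠ 0 := by positivity
    obtain ⟨q', rfl⟩ := Nat.exists_eq_add_of_le' hq
    rw [Nat.add_sub_cancel, show (K : ℝ) ^ 2 / P = K * (K / P) by ring, mul_pow, pow_succ (K : ℝ)]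
    field_simp
  · have h2 : ∀ B ∈ powersetCard q (S \ T), ∑ C ∈ powersetCard q (T \ S),
        ∑ R, ringWeight K P R * (if B ∪ C ⊆ R then (1 : ℝ) else 0) ≤
        (K : ℝ) ^ q * ((K : ℝ) / P) ^ (2 * q) := by
      intro B hB
      obtain ⟨hB1, hB2⟩ := mem_powersetCard.1 hB
      have h3 : ∀ C ∈ powersetCard q (T \ S),
          ∑ R, ringWeight K P R * (if B ∪ C ⊆ R then (1 : ℝ) else 0) ≤
          ((K : ℝ) / P) ^ (2 * q) := by
        intro C hC
        obtain ⟨hC1, hC2⟩ := mem_powersetCard.1 hC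
        have h4 := sum_ringWeight_subset_le hKP (B ∪ C)
        have hd : Disjoint B C := disjoint_left.2 fun x h5 h6 =>
          (mem_sdiff.1 (hC1 h6)).2 (mem_sdiff.1 (hB1 h5)).1
        rw [card_union_of_disjoint hd, hB2, hC2, ← two_mul] at h4
        exact h4
      refine (sum_le_card_nsmul _ _ _ h3).trans ?_
      rw [nsmul_eq_mul, card_powersetCard]
      refine mul_le_mul_of_nonneg_right ?_ (by positivity)
      have h4 := Nat.choose_le_pow (#(T \ S)) q
      have h5 : #(T \ S) ^ q ≤ K ^ q :=
        Nat.pow_le_pow_left (hT ▸ card_le_card sdiff_subset) _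
      exact_mod_cast h4.trans h5
    refine (sum_le_card_nsmul _ _ _ h2).trans ?_
    rw [nsmul_eq_mul, card_powersetCard]
    have h4 : ((#(S \ T)).choose q : ℝ) ≤ (K : ℝ) ^ q := by
      have h4 := Nat.choose_le_pow (#(S \ T)) q
      have h5 : #(S \ T) ^ q ≤ K ^ q :=
        Nat.pow_le_pow_left (hS ▸ card_le_card sdiff_subset) _
      exact_mod_cast h4.trans h5
    calc _ ≤ (K : ℝ) ^ q * ((K : ℝ) ^ q * ((K : ℝ) / P) ^ (2 * q)) :=
          mul_le_mul_of_nonneg_right h4 (by positivity)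
      _ = _ := by
          rw [show (K : ℝ) ^ 2 / P = K * (K / P) by ring, mul_pow, mul_comm 2 q, pow_mul]
          ring

end Rings

section NeighbourPatterns

variable {a : Type*} [Fintype a] {q K P : ℕ} {p : ℝ} {S : a → Finset (Fin P)}

theorem linkProb_mem_Icc (hp0 : 0 ≤ p) (hp1 : p ≤ 1) (q : ℕ) (T R : Finset (Fin P)) :
    linkProb q P p T R ∈ Set.Icc 0 1 := by
  unfold linkProb
  split_ifs
  · exact ⟨hp0, hp1⟩
  · simp

theorem nbrProb_nonneg [DecidableEq a] (hp0 : 0 ≤ p) (hp1 : p ≤ 1) (q K : ℕ) (S : a → Finset (Fin P))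
    (t : Finset a) : 0 ≤ nbrProb q K P p S t := by
  refine sum_nonneg fun R _ => mul_nonneg (ringWeight_nonneg K P R) (prod_nonneg fun i _ => ?_)
  obtain ⟨h1, h2⟩ := linkProb_mem_Icc hp0 hp1 q (S i) R
  split_ifs <;> linarith

theorem sum_superset_prod_ite [DecidableEq a] (x : a → ℝ) (s : Finset a) :
    ∑ t with s ⊆ t, ∏ i, (if i ∈ t then x i else 1 - x i) = ∏ i ∈ s, x i := by
  have h := Fintype.prod_add x fun i => if i ∈ s then 0 else 1 - x i
  have h1 : ∏ i, (x i + if i ∈ s then 0 else 1 - x i) = ∏ i ∈ s, x i := by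
    rw [← prod_subset (subset_univ s)]
    · exact prod_congr rfl fun i hi => by rw [if_pos hi, add_zero]
    · intro i _ hi
      rw [if_neg hi]
      ring
  rw [← h1, h, sum_filter]
  refine sum_congr rfl fun t _ => ?_
  split_ifs with ht
  · rw [← prod_mul_prod_compl t]
    congr 1
    · exact prod_congr rfl fun i hi => by rw [if_pos hi]
    · refine prod_congr rfl fun i hi => ?_
      rw [mem_compl] at hi
      rw [if_neg hi, if_neg fun h => hi (ht h)]
  · obtain ⟨i, his, hit⟩ := not_subset.1 ht
    rw [prod_eq_zero (i := i) (s := tᶜ) (mem_compl.2 hit), mul_zero]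
    rw [if_pos his]

theorem sum_nbrProb_mul_subset [DecidableEq a] (s : Finset a) :
    ∑ t, nbrProb q K P p S t * (if s ⊆ t then 1 else 0)
      = ∑ R, ringWeight K P R * ∏ i ∈ s, linkProb q P p (S i) R := by
  simp only [mul_ite, mul_one, mul_zero]
  rw [← sum_filter]
  unfold nbrProb
  rw [sum_comm]
  refine sum_congr rfl fun R _ => ?_
  rw [← mul_sum, sum_superset_prod_ite]

theorem sum_nbrProb [DecidableEq a] (hKP : K ≤ P) : ∑ t, nbrProb q K P p S t = 1 := by
  have h := sum_nbrProb_mul_subset (q := q) (K := K) (p := p) (S := S) ∅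
  simpa [sum_ringWeight hKP] using h

theorem sum_nbrProb_mul_mem [DecidableEq a] (hKP : K ≤ P) (hS : ∀ i, #(S i) = K) (i : a) :
    ∑ t, nbrProb q K P p S t * (if i ∈ t then 1 else 0) = peq q K P p := by
  have h := sum_nbrProb_mul_subset (q := q) (K := K) (p := p) (S := S) {i}
  simpa [sum_ringWeight_linkProb hKP q p (hS i)] using h

theorem sum_nbrProb_mul_mem_mem [DecidableEq a] {i j : a} (hij : i ≠ j) :
    ∑ t, nbrProb q K P p S t * (if i ∈ t ∧ j ∈ t then 1 else 0) = jointProb q K P p (S i) (S j) := by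
  have h := sum_nbrProb_mul_subset (q := q) (K := K) (p := p) (S := S) {i, j}
  simpa [insert_subset_iff, prod_pair hij, jointProb] using h

/-- Sum over the ordered pairs of distinct vertices of the probability that a further vertex is
adjacent to both. -/
noncomputable def pairProb (q K P : ℕ) (p : ℝ) (S : a → Finset (Fin P)) : ℝ :=
  ∑ e ∈ (univ : Finset a).offDiag, jointProb q K P p (S e.1) (S e.2)

theorem sum_nbrProb_mul_card [DecidableEq a] (hKP : K ≤ P) (hS : ∀ i, #(S i) = K) :
    ∑ t, nbrProb q K P p S t * (#t : ℝ) = Fintype.card a * peq q K P p := by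
  have h : ∀ t : Finset a, (#t : ℝ) = ∑ i, if i ∈ t then 1 else 0 := by simp
  simp only [h, mul_sum]
  rw [sum_comm, sum_congr rfl fun i _ => sum_nbrProb_mul_mem hKP hS i]
  simp

theorem sum_nbrProb_mul_card_offDiag [DecidableEq a] :
    ∑ t, nbrProb q K P p S t * ((#t : ℝ) * (#t - 1)) = pairProb q K P p S := by
  have h : ∀ t : Finset a, (#t : ℝ) * (#t - 1)
      = ∑ e ∈ (univ : Finset a).offDiag, if e.1 ∈ t ∧ e.2 ∈ t then 1 else 0 := by
    intro t
    rw [sum_boole]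
    have : ((univ : Finset a).offDiag.filter fun e => e.1 ∈ t ∧ e.2 ∈ t) = t.offDiag := by
      ext e
      simp only [mem_filter, mem_offDiag, mem_univ, true_and]
      tauto
    rw [this, offDiag_card, Nat.cast_sub (Nat.le_mul_self _)]
    push_cast
    ring
  simp only [h, mul_sum]
  rw [sum_comm]
  exact sum_congr rfl fun e he => sum_nbrProb_mul_mem_mem (mem_offDiag.1 he).2.2

theorem nbrProb_eq_sum_mul [DecidableEq a] (s : Finset a) :
    nbrProb q K P p S s = ∑ t, nbrProb q K P p S t * (if t = s then 1 else 0) := by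
  simp

theorem le_nbrProb_empty [DecidableEq a] (hp0 : 0 ≤ p) (hp1 : p ≤ 1) (hKP : K ≤ P) (hS : ∀ i, #(S i) = K) :
    1 - Fintype.card a * peq q K P p ≤ nbrProb q K P p S ∅ := by
  have h1 : 1 - Fintype.card a * peq q K P p = ∑ t, nbrProb q K P p S t * (1 - #t) := by
    simp only [mul_sub, mul_one, sum_sub_distrib, sum_nbrProb hKP, sum_nbrProb_mul_card hKP hS]
  rw [nbrProb_eq_sum_mul, h1]
  refine sum_le_sum fun t _ => mul_le_mul_of_nonneg_left ?_ (nbrProb_nonneg hp0 hp1 q K S t)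
  split_ifs with h
  · simp
  · have : (1 : ℝ) ≤ #t := by
      exact_mod_cast card_pos.2 (nonempty_iff_ne_empty.2 h)
    linarith

theorem nbrProb_empty_le [DecidableEq a] (hp0 : 0 ≤ p) (hp1 : p ≤ 1) (hKP : K ≤ P) (hS : ∀ i, #(S i) = K) :
    nbrProb q K P p S ∅ ≤ 1 - (Fintype.card a * peq q K P p - pairProb q K P p S) := by
  have h1 : 1 - (Fintype.card a * peq q K P p - pairProb q K P p S)
      = ∑ t, nbrProb q K P p S t * (1 - (#t - #t * (#t - 1))) := by
    simp only [mul_sub _ (1 : ℝ), mul_sub _ (#_ : ℝ) (_ * _), mul_one, sum_sub_distrib,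
      sum_nbrProb hKP, sum_nbrProb_mul_card hKP hS, ← sum_nbrProb_mul_card_offDiag]
  rw [nbrProb_eq_sum_mul, h1]
  refine sum_le_sum fun t _ => mul_le_mul_of_nonneg_left ?_ (nbrProb_nonneg hp0 hp1 q K S t)
  split_ifs with h
  · simp [h]
  · nlinarith [sq_nonneg ((#t : ℝ) - 1)]

theorem nbrProb_singleton_le [DecidableEq a] (hp0 : 0 ≤ p) (hp1 : p ≤ 1) (hKP : K ≤ P) (hS : ∀ i, #(S i) = K)
    (i : a) : nbrProb q K P p S {i} ≤ peq q K P p := by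
  rw [nbrProb_eq_sum_mul, ← sum_nbrProb_mul_mem hKP hS i]
  refine sum_le_sum fun t _ => mul_le_mul_of_nonneg_left ?_ (nbrProb_nonneg hp0 hp1 q K S t)
  split_ifs with h h' <;> simp_all

theorem le_nbrProb_singleton [DecidableEq a] (hp0 : 0 ≤ p) (hp1 : p ≤ 1) (hKP : K ≤ P) (hS : ∀ i, #(S i) = K)
    (i : a) : peq q K P p - pairProb q K P p S ≤ nbrProb q K P p S {i} := by
  rw [nbrProb_eq_sum_mul, ← sum_nbrProb_mul_mem hKP hS i, ← sum_nbrProb_mul_card_offDiag,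
    ← sum_sub_distrib]
  refine sum_le_sum fun t _ => ?_
  rw [← mul_sub]
  refine mul_le_mul_of_nonneg_left ?_ (nbrProb_nonneg hp0 hp1 q K S t)
  by_cases hi : i ∈ t
  · have h1 : (1 : ℝ) ≤ #t := by exact_mod_cast card_pos.2 ⟨i, hi⟩
    rw [if_pos hi]
    split_ifs with h
    · nlinarith
    · have h2 : 2 ≤ #t := by
        by_contra h3
        have h4 : #t = 1 := by
          have := card_pos.2 ⟨i, hi⟩
          omega
        obtain ⟨j, rfl⟩ := card_eq_one.1 h4
        exact h (by rw [mem_singleton.1 hi])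
      have : (2 : ℝ) ≤ #t := by exact_mod_cast h2
      nlinarith
  · rw [if_neg hi, if_neg (by rintro rfl; simp at hi)]
    have : (0 : ℝ) ≤ (#t : ℝ) * (#t - 1) := by
      rcases Nat.eq_zero_or_pos #t with h | h
      · simp [h]
      · have : (1 : ℝ) ≤ #t := by exact_mod_cast h
        nlinarith
    linarith

theorem sum_nbrProb_one_lt_card_le [DecidableEq a] (hp0 : 0 ≤ p) (hp1 : p ≤ 1) :
    ∑ t with 1 < #t, nbrProb q K P p S t ≤ pairProb q K P p S := by
  rw [← sum_nbrProb_mul_card_offDiag, sum_filter]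
  refine sum_le_sum fun t _ => ?_
  have h0 := nbrProb_nonneg hp0 hp1 q K S t
  split_ifs with h
  · have : (2 : ℝ) ≤ #t := by exact_mod_cast h
    exact le_mul_of_one_le_right h0 (by nlinarith)
  · refine mul_nonneg h0 ?_
    interval_cases h' : #t <;> simp

end NeighbourPatterns

section ConditionalBounds

variable {a b : Type*} [Fintype a] [DecidableEq a] [Fintype b] [DecidableEq b]
  {q K P : ℕ} {p : ℝ} {S : a → Finset (Fin P)}

theorem patternSum_nbrProb_le (hp0 : 0 ≤ p) (hp1 : p ≤ 1) (hKP : K ≤ P) (hS : ∀ i, #(S i) = K)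
    (r : ℕ) {x D : ℝ} (hx : 0 < x) (hx1 : x ≤ 1) (hD : pairProb q K P p S ≤ D) :
    patternSum b (nbrProb q K P p S) r ≤ (x ^ (Fintype.card a * r))⁻¹ *
      Real.exp (-((1 - x) * (Fintype.card a * peq q K P p - D))) ^ Fintype.card b := by
  have h0 := nbrProb_nonneg hp0 hp1 q K S
  have h1 := sum_nbrProb (q := q) (p := p) (S := S) hKP
  refine (patternSum_le_exponential _ h0 h1 r x hx hx1).trans ?_
  have h2 := nbrProb_empty_le (q := q) hp0 hp1 hKP hS
  refine mul_le_mul_of_nonneg_left (pow_le_pow_left₀ ?_ ?_ _) (by positivity)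
  · nlinarith [h0 ∅]
  · refine le_trans ?_ (Real.add_one_le_exp _)
    nlinarith [h0 ∅]

theorem patternSum_nbrProb_le_of_pairProb_le (hp0 : 0 ≤ p) (hp1 : p ≤ 1) (hKP : K ≤ P)
    (hS : ∀ i, #(S i) = K) (r : ℕ) {x z D : ℝ} (hx : 0 < x) (hx1 : x ≤ 1) (hz : 1 ≤ z)
    (hD : pairProb q K P p S ≤ D) (hρ : 0 ≤ peq q K P p) :
    patternSum b (nbrProb q K P p S) r ≤
      Real.exp (-(Fintype.card a * peq q K P p - D)) ^ (Fintype.card b - Fintype.card a * r) *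
        (∑ j ∈ range (r + 1), ((Fintype.card b).choose j : ℝ) * peq q K P p ^ j) ^ Fintype.card a +
      (x ^ (Fintype.card a * r))⁻¹ * z⁻¹ *
        Real.exp (-((1 - x) * (Fintype.card a * peq q K P p - D)) + z * D) ^ Fintype.card b := by
  have h0 := nbrProb_nonneg hp0 hp1 q K S
  have h1 := sum_nbrProb (q := q) (p := p) (S := S) hKP
  refine (patternSum_le_of_card_le_one _ h0 h1 r x z _ hx hx1 hz
    (nbrProb_singleton_le hp0 hp1 hKP hS)).trans ?_
  have h2 := nbrProb_empty_le (q := q) hp0 hp1 hKP hS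
  have h3 := sum_nbrProb_one_lt_card_le (q := q) (K := K) (S := S) hp0 hp1
  have h4 : 0 ≤ ∑ t with 1 < #t, nbrProb q K P p S t := sum_nonneg fun t _ => h0 t
  have h5 : nbrProb q K P p S ∅ ≤ 1 :=
    h1 ▸ single_le_sum (fun t _ => h0 t) (mem_univ ∅)
  refine add_le_add (mul_le_mul_of_nonneg_right (pow_le_pow_left₀ (h0 ∅) ?_ _) (by positivity))
    (mul_le_mul_of_nonneg_left (pow_le_pow_left₀ ?_ ?_ _) (by positivity))
  · refine le_trans ?_ (Real.add_one_le_exp _)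
    linarith
  · have : 0 ≤ z * ∑ t with 1 < #t, nbrProb q K P p S t := by positivity
    nlinarith [h0 ∅]
  · refine le_trans ?_ (Real.add_one_le_exp _)
    have h6 : z * ∑ t with 1 < #t, nbrProb q K P p S t ≤ z * D :=
      mul_le_mul_of_nonneg_left (h3.trans hD) (by linarith)
    nlinarith [h0 ∅]

theorem exp_neg_le_one_sub {y : ℝ} (hy : y ≤ 1 / 2) :
    Real.exp (-(y + 2 * y ^ 2)) ≤ 1 - y := by
  have h1 : 0 < 1 - y := by linarith
  rw [Real.exp_neg, inv_le_comm₀ (Real.exp_pos _) h1]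
  refine le_trans ?_ (Real.add_one_le_exp _)
  rw [inv_le_iff_one_le_mul₀ h1]
  nlinarith [sq_nonneg y, mul_nonneg (sq_nonneg y) (by linarith : 0 ≤ 1 - 2 * y)]

theorem le_patternSum_nbrProb (hp0 : 0 ≤ p) (hp1 : p ≤ 1) (hKP : K ≤ P)
    (hS : ∀ i, #(S i) = K) (r : ℕ) {D : ℝ} (hD : pairProb q K P p S ≤ D)
    (hρ : Fintype.card a * peq q K P p ≤ 1 / 2) (hρD : D ≤ peq q K P p) :
    (((Fintype.card b - Fintype.card a * r).choose r : ℝ) * (peq q K P p - D) ^ r) ^ Fintype.card a *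
      Real.exp (-(Fintype.card a * peq q K P p + 2 * (Fintype.card a * peq q K P p) ^ 2)) ^
        Fintype.card b ≤ patternSum b (nbrProb q K P p S) r := by
  refine le_trans ?_ (le_patternSum _ (nbrProb_nonneg hp0 hp1 q K S)
    (sum_nbrProb (q := q) (p := p) (S := S) hKP) r (peq q K P p - D) (by linarith) fun i =>
      le_trans (by linarith) (le_nbrProb_singleton hp0 hp1 hKP hS i))
  refine mul_le_mul_of_nonneg_left (pow_le_pow_left₀ (Real.exp_pos _).le ?_ _) ?_
  · exact (exp_neg_le_one_sub hρ).trans (le_nbrProb_empty hp0 hp1 hKP hS)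
  · have : 0 ≤ peq q K P p - D := by linarith
    positivity

end ConditionalBounds

section Overlap

variable {a : Type*} [Fintype a] {q K P : ℕ} {p : ℝ}

/-- Number of coincidences between the key rings of distinct vertices. -/
def overlap (S : a → Finset (Fin P)) : ℕ :=
  ∑ e ∈ (univ : Finset a).offDiag, #(S e.1 ∩ S e.2)

theorem overlap_eq_zero_iff {S : a → Finset (Fin P)} :
    overlap S = 0 ↔ ∀ i j, i ≠ j → Disjoint (S i) (S j) := by
  simp [overlap, sum_eq_zero_iff, mem_offDiag, disjoint_iff_inter_eq_empty]

theorem pairProb_le (hq : 1 ≤ q) (hK : 0 < K) (hKP : K ≤ P) {S : a → Finset (Fin P)}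
    (hS : ∀ i, #(S i) = K) {C : ℝ} (hC : p * ((K : ℝ) ^ 2 / P) ^ q ≤ C * peq q K P p)
    (hp0 : 0 ≤ p) :
    pairProb q K P p S ≤ C * peq q K P p * p / K * overlap S +
      ((Fintype.card a : ℝ) * C) ^ 2 * peq q K P p ^ 2 := by
  have hκ : 0 ≤ p * ((K : ℝ) ^ 2 / P) ^ q := by positivity
  have h1 : ∀ e ∈ (univ : Finset a).offDiag, jointProb q K P p (S e.1) (S e.2) ≤
      C * peq q K P p * p / K * #(S e.1 ∩ S e.2) + (C * peq q K P p) ^ 2 := by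
    intro e _
    refine (jointProb_le hq hK hKP p (hS e.1) (hS e.2)).trans ?_
    calc p ^ 2 * ((#(S e.1 ∩ S e.2) : ℝ) / K * ((K : ℝ) ^ 2 / P) ^ q +
          (((K : ℝ) ^ 2 / P) ^ q) ^ 2)
        = (p * ((K : ℝ) ^ 2 / P) ^ q) * p / K * #(S e.1 ∩ S e.2) +
          (p * ((K : ℝ) ^ 2 / P) ^ q) ^ 2 := by ring
      _ ≤ _ := by gcongr
  refine (sum_le_sum h1).trans ?_
  rw [sum_add_distrib, ← mul_sum, sum_const, nsmul_eq_mul, overlap, Nat.cast_sum]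
  refine add_le_add le_rfl ?_
  rw [offDiag_card, Finset.card_univ]
  have h2 : ((Fintype.card a * Fintype.card a - Fintype.card a : ℕ) : ℝ) ≤
      (Fintype.card a : ℝ) ^ 2 := by
    rw [sq]
    exact_mod_cast Nat.sub_le _ _
  calc _ ≤ (Fintype.card a : ℝ) ^ 2 * (C * peq q K P p) ^ 2 := by gcongr
    _ = _ := by ring

theorem exp_overlap_le {S : a → Finset (Fin P)} (hS : overlap S ≠ 0) {θ : ℝ} (hθ : 0 ≤ θ) :
    Real.exp (θ * overlap S) ≤ ∑ e ∈ (univ : Finset a).offDiag,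
      ((2 * Real.exp (θ * #(univ : Finset a).offDiag)) ^ #(S e.1 ∩ S e.2) - 1) := by
  set w := Real.exp (θ * #(univ : Finset a).offDiag) with hw
  have hw1 : 1 ≤ w := Real.one_le_exp (by positivity)
  have hne : (univ : Finset a).offDiag.Nonempty := by
    rw [nonempty_iff_ne_empty]
    intro h
    exact hS (by rw [overlap, h, sum_empty])
  obtain ⟨e, he, hmax⟩ := exists_max_image _ (fun e => #(S e.1 ∩ S e.2)) hne
  have h1 : overlap S ≤ #(univ : Finset a).offDiag * #(S e.1 ∩ S e.2) := by
    rw [← smul_eq_mul]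
    exact sum_le_card_nsmul _ _ _ hmax
  have h2 : #(S e.1 ∩ S e.2) ≠ 0 := by
    intro h
    rw [h, mul_zero] at h1
    omega
  have h3 : Real.exp (θ * overlap S) ≤ w ^ #(S e.1 ∩ S e.2) := by
    rw [hw, ← Real.exp_nat_mul]
    refine Real.exp_le_exp.2 ?_
    calc θ * overlap S ≤ θ * (#(univ : Finset a).offDiag * #(S e.1 ∩ S e.2) : ℕ) := by
          gcongr
      _ = _ := by push_cast; ring
  have h4 : w ^ #(S e.1 ∩ S e.2) ≤ (2 * w) ^ #(S e.1 ∩ S e.2) - 1 := by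
    have h5 : (2 : ℝ) ≤ 2 ^ #(S e.1 ∩ S e.2) := le_self_pow₀ (by norm_num) h2
    have h6 : 1 ≤ w ^ #(S e.1 ∩ S e.2) := one_le_pow₀ hw1
    rw [mul_pow]
    nlinarith
  refine (h3.trans h4).trans (single_le_sum
    (f := fun e : a × a => (2 * w) ^ #(S e.1 ∩ S e.2) - 1) (fun e' _ => ?_) he)
  exact sub_nonneg.2 (one_le_pow₀ (by linarith))

theorem prod_ringWeight_nonneg (K P : ℕ) (S : a → Finset (Fin P)) :
    0 ≤ ∏ i, ringWeight K P (S i) :=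
  prod_nonneg fun i _ => ringWeight_nonneg K P (S i)

theorem sum_prod_ringWeight [DecidableEq a] (hKP : K ≤ P) :
    ∑ S : a → Finset (Fin P), ∏ i, ringWeight K P (S i) = 1 := by
  rw [← Fintype.prod_sum fun _ : a => ringWeight K P]
  simp [sum_ringWeight hKP]

theorem prod_ringWeight_mul_le_mul {S : a → Finset (Fin P)} {x y : ℝ}
    (h : (∀ i, #(S i) = K) → x ≤ y) :
    (∏ i, ringWeight K P (S i)) * x ≤ (∏ i, ringWeight K P (S i)) * y := by
  by_cases hS : ∀ i, #(S i) = K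
  · exact mul_le_mul_of_nonneg_left (h hS) (prod_ringWeight_nonneg K P S)
  · push Not at hS
    obtain ⟨i, hi⟩ := hS
    rw [prod_eq_zero (mem_univ i) (by rw [ringWeight, if_neg hi]), zero_mul, zero_mul]

theorem sum_prod_ringWeight_pow_card_inter_le [DecidableEq a] (hKP : K ≤ P) {z : ℝ} (hz : 1 ≤ z) {i j : a}
    (hij : i ≠ j) :
    ∑ S : a → Finset (Fin P), (∏ l, ringWeight K P (S l)) * z ^ #(S i ∩ S j)
      ≤ Real.exp ((z - 1) * ((K : ℝ) ^ 2 / P)) := by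
  rw [Fintype.sum_equiv (Equiv.funSplitAt j (Finset (Fin P))) _
    (fun x => (ringWeight K P x.1 * ∏ l, ringWeight K P (x.2 l)) * z ^ #(x.2 ⟨i, hij⟩ ∩ x.1))]
  · rw [Fintype.sum_prod_type_right]
    have h1 : ∀ S : {l // l ≠ j} → Finset (Fin P),
        ∑ R, (ringWeight K P R * ∏ l, ringWeight K P (S l)) * z ^ #(S ⟨i, hij⟩ ∩ R)
          ≤ (∏ l, ringWeight K P (S l)) * Real.exp ((z - 1) * ((K : ℝ) ^ 2 / P)) := by
      intro S
      refine le_trans (le_of_eq ?_) (prod_ringWeight_mul_le_mul fun hS =>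
        sum_ringWeight_pow_card_inter_le hKP (hS ⟨i, hij⟩) hz)
      rw [mul_sum]
      exact sum_congr rfl fun R _ => by ring
    refine (sum_le_sum fun S _ => h1 S).trans ?_
    rw [← sum_mul, sum_prod_ringWeight hKP, one_mul]
  · intro S
    simp only [Equiv.funSplitAt_apply]
    rw [Fintype.prod_eq_mul_prod_subtype_ne (fun l => ringWeight K P (S l)) j]

theorem sum_prod_ringWeight_overlap_le [DecidableEq a] (hKP : K ≤ P) {z : ℝ} (hz : 1 ≤ z) :
    ∑ S : a → Finset (Fin P), (∏ l, ringWeight K P (S l)) *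
        ∑ e ∈ (univ : Finset a).offDiag, (z ^ #(S e.1 ∩ S e.2) - 1)
      ≤ #(univ : Finset a).offDiag * (Real.exp ((z - 1) * ((K : ℝ) ^ 2 / P)) - 1) := by
  simp only [mul_sum]
  rw [sum_comm, ← nsmul_eq_mul]
  refine sum_le_card_nsmul _ _ _ fun e he => ?_
  simp only [mul_sub, mul_one, sum_sub_distrib, sum_prod_ringWeight hKP]
  exact sub_le_sub_right
    (sum_prod_ringWeight_pow_card_inter_le hKP hz (mem_offDiag.1 he).2.2) _

end Overlap

/-- Upper bound for the contribution of the patterns in which no vertex is adjacent to two of the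
`m` marked vertices. -/
noncomputable def singleBound (m r : ℕ) (E : ℝ) (n : ℕ) (ρ : ℝ) : ℝ :=
  Real.exp (-(m * ρ - E * ρ ^ 2)) ^ (n - m - m * r) *
    (∑ j ∈ range (r + 1), ((n - m).choose j : ℝ) * ρ ^ j) ^ m

/-- Upper bound for the contribution of the patterns in which some vertex is adjacent to two of the
`m` marked vertices. -/
noncomputable def multiBound (m r : ℕ) (E : ℝ) (n : ℕ) (ρ : ℝ) : ℝ :=
  (n * ρ) ^ (m * r) * (n * ρ ^ 2) *
    Real.exp (-((1 - (n * ρ)⁻¹) * (m * ρ - E * ρ ^ 2)) + E / n) ^ (n - m)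

/-- Upper bound for the contribution of all patterns. -/
noncomputable def coarseBound (m r : ℕ) (E : ℝ) (n : ℕ) (ρ : ℝ) : ℝ :=
  (n * ρ) ^ (m * r) * Real.exp (-((1 - (n * ρ)⁻¹) * (m * ρ - E * ρ ^ 2))) ^ (n - m)

/-- Lower bound for the probability that `m` marked vertices with disjoint key rings have degree
at most `r`. -/
noncomputable def disjointBound (m r : ℕ) (E : ℝ) (n : ℕ) (ρ : ℝ) : ℝ :=
  (((n - m - m * r).choose r : ℝ) * (ρ - E * ρ ^ 2) ^ r) ^ m *
    Real.exp (-(m * ρ + 2 * (m * ρ) ^ 2)) ^ (n - m)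

/-- Upper bound for the exponential moment of the overlap of `m` random key rings on the event that
they are not disjoint. -/
noncomputable def overlapBound (m : ℕ) (θ κ : ℝ) : ℝ :=
  (m * m - m : ℕ) * (Real.exp ((2 * Real.exp (θ * (m * m - m : ℕ)) - 1) * κ) - 1)

theorem overlapBound_eq (a : Type*) [Fintype a] (θ κ : ℝ) :
    overlapBound (Fintype.card a) θ κ = #(univ : Finset a).offDiag *
      (Real.exp ((2 * Real.exp (θ * #(univ : Finset a).offDiag) - 1) * κ) - 1) := by
  rw [overlapBound, offDiag_card, Finset.card_univ]

section Sandwich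

variable {q K P n : ℕ} {p C : ℝ}

theorem prob_degree_le_le_bounds (hq : 1 ≤ q) (hK : 0 < K) (hKP : K ≤ P) (hp0 : 0 ≤ p) (hp1 : p ≤ 1)
    (hC : p * ((K : ℝ) ^ 2 / P) ^ q ≤ C * peq q K P p) (hC0 : 0 ≤ C)
    (hρ : 0 < peq q K P p) (h1 : 1 ≤ n * peq q K P p) (h2 : n * peq q K P p ^ 2 ≤ 1)
    (A : Finset (Fin n)) (r : ℕ) :
    prob n K P p {ω | ∀ i ∈ A, degree q n P ω i ≤ r} ≤
      singleBound #A r ((#A * C) ^ 2) n (peq q K P p) +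
      multiBound #A r ((#A * C) ^ 2) n (peq q K P p) +
      coarseBound #A r ((#A * C) ^ 2) n (peq q K P p) *
        overlapBound #A (n * (C * peq q K P p * p / K)) ((K : ℝ) ^ 2 / P) := by
  set ρ := peq q K P p with hρdef
  set θ := n * (C * ρ * p / K) with hθ
  have hn : (0 : ℝ) < n := by
    rcases Nat.eq_zero_or_pos n with h | h
    · rw [h] at h1
      norm_num at h1
    · exact_mod_cast h
  have hca : Fintype.card {i // i ∈ A} = #A := Fintype.card_coe A
  have hcb : Fintype.card {v // v ∉ A} = n - #A := by
    rw [Fintype.card_subtype_compl, Fintype.card_fin, hca]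
  have hx : 0 < (n * ρ)⁻¹ := by positivity
  have hx1 : (n * ρ)⁻¹ ≤ 1 := inv_le_one_of_one_le₀ h1
  have hz : 1 ≤ (n * ρ ^ 2)⁻¹ := (one_le_inv₀ (by positivity)).2 h2
  have hzE : (n * ρ ^ 2)⁻¹ * ((#A * C) ^ 2 * ρ ^ 2) = (#A * C) ^ 2 / n := by
    field_simp
  have hS0 : 0 ≤ singleBound #A r ((#A * C) ^ 2) n ρ + multiBound #A r ((#A * C) ^ 2) n ρ := by
    unfold singleBound multiBound
    positivity
  have hG0 : 0 ≤ coarseBound #A r ((#A * C) ^ 2) n ρ := by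
    unfold coarseBound
    positivity
  set w := 2 * Real.exp (θ * #(univ : Finset {i // i ∈ A}).offDiag) with hw
  have hw1 : 1 ≤ w := by
    have : 1 ≤ Real.exp (θ * #(univ : Finset {i // i ∈ A}).offDiag) :=
      Real.one_le_exp (by positivity)
    linarith
  have hpt : ∀ S : {i // i ∈ A} → Finset (Fin P), (∀ i, #(S i) = K) →
      patternSum {v // v ∉ A} (nbrProb q K P p S) r ≤
        (singleBound #A r ((#A * C) ^ 2) n ρ + multiBound #A r ((#A * C) ^ 2) n ρ) +
        coarseBound #A r ((#A * C) ^ 2) n ρ *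
          ∑ e ∈ (univ : Finset {i // i ∈ A}).offDiag, (w ^ #(S e.1 ∩ S e.2) - 1) := by
    intro S hS
    have hD := pairProb_le hq hK hKP hS hC hp0
    rw [hca, ← hρdef] at hD
    by_cases h0 : overlap S = 0
    · rw [h0, Nat.cast_zero, mul_zero, zero_add] at hD
      have h := patternSum_nbrProb_le_of_pairProb_le (b := {v // v ∉ A}) hp0 hp1 hKP hS r hx hx1 hz
        hD hρ.le
      rw [hca, hcb, hzE, ← hρdef, inv_inv, inv_pow, inv_inv] at h
      refine h.trans (le_add_of_nonneg_right (mul_nonneg hG0 (sum_nonneg fun e _ => ?_)))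
      exact sub_nonneg.2 (one_le_pow₀ hw1)
    · have h := patternSum_nbrProb_le (b := {v // v ∉ A}) hp0 hp1 hKP hS r hx hx1 hD
      rw [hca, hcb, ← hρdef, inv_pow, inv_inv] at h
      refine (h.trans ?_).trans (le_add_of_nonneg_left hS0)
      have hθ0 : 0 ≤ θ := by positivity
      refine le_trans ?_ (mul_le_mul_of_nonneg_left (exp_overlap_le h0 hθ0) hG0)
      rw [coarseBound, mul_assoc (_ ^ _)]
      refine mul_le_mul_of_nonneg_left ?_ (pow_nonneg (by positivity) _)
      rw [← Real.exp_nat_mul, ← Real.exp_nat_mul, ← Real.exp_add, Real.exp_le_exp]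
      have hle : ((n - #A : ℕ) : ℝ) * (1 - (n * ρ)⁻¹) ≤ n := by
        have h3 : ((n - #A : ℕ) : ℝ) ≤ n := by exact_mod_cast Nat.sub_le _ _
        exact (mul_le_of_le_one_right (Nat.cast_nonneg _) (by linarith)).trans h3
      have h4 := mul_le_mul_of_nonneg_right hle
        (by positivity : 0 ≤ C * ρ * p / K * (overlap S : ℝ))
      rw [hθ]
      nlinarith
  refine (prob_degree_le_le q n K P hp0 hp1 A r).trans ((sum_le_sum fun S _ =>
    prod_ringWeight_mul_le_mul (hpt S)).trans ?_)
  simp only [mul_add _ (_ + _), sum_add_distrib, ← sum_mul, sum_prod_ringWeight hKP, one_mul]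
  refine add_le_add le_rfl ?_
  have h5 := sum_prod_ringWeight_overlap_le (a := {i // i ∈ A}) hKP hw1
  refine le_trans (le_of_eq ?_) (mul_le_mul_of_nonneg_left (h5.trans (le_of_eq ?_)) hG0)
  · rw [mul_sum]
    exact sum_congr rfl fun S _ => by ring
  · rw [← hca, overlapBound_eq]

theorem le_prob_degree_le_bounds (hq : 1 ≤ q) (hK : 0 < K) (hKP : K ≤ P) (hp0 : 0 ≤ p)
    (hp1 : p ≤ 1) (hC : p * ((K : ℝ) ^ 2 / P) ^ q ≤ C * peq q K P p) {m : ℕ}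
    (hm : m * peq q K P p ≤ 1 / 2)
    (hD : (m * C) ^ 2 * peq q K P p ^ 2 ≤ peq q K P p) (A : Finset (Fin n)) (hA : #A = m) (r : ℕ) :
    disjointBound m r ((m * C) ^ 2) n (peq q K P p) *
        (1 - overlapBound m 0 ((K : ℝ) ^ 2 / P)) ≤
      prob n K P p {ω | ∀ i ∈ A, degree q n P ω i ≤ r} := by
  subst hA
  set ρ := peq q K P p with hρdef
  have hca : Fintype.card {i // i ∈ A} = #A := Fintype.card_coe A
  have hcb : Fintype.card {v // v ∉ A} = n - #A := by
    rw [Fintype.card_subtype_compl, Fintype.card_fin, hca]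
  have hL0 : 0 ≤ disjointBound #A r ((#A * C) ^ 2) n ρ := by
    have : 0 ≤ ρ - (#A * C) ^ 2 * ρ ^ 2 := by linarith
    unfold disjointBound
    positivity
  refine le_trans ?_ (le_prob_degree_le hq n K P hp0 hp1 A r)
  have hpt : ∀ S : {i // i ∈ A} → Finset (Fin P), (∀ i, #(S i) = K) →
      disjointBound #A r ((#A * C) ^ 2) n ρ * (1 -
          ∑ e ∈ (univ : Finset {i // i ∈ A}).offDiag, (2 ^ #(S e.1 ∩ S e.2) - 1)) ≤
        (if ∀ i j, i ≠ j → Disjoint (S i) (S j) then 1 else 0) *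
          patternSum {v // v ∉ A} (nbrProb q K P p S) r := by
    intro S hS
    have hsum : ∀ e ∈ (univ : Finset {i // i ∈ A}).offDiag,
        (0 : ℝ) ≤ 2 ^ #(S e.1 ∩ S e.2) - 1 :=
      fun e _ => sub_nonneg.2 (one_le_pow₀ (by norm_num))
    split_ifs with h
    · have hD' := pairProb_le hq hK hKP hS hC hp0
      rw [hca, overlap_eq_zero_iff.2 h, Nat.cast_zero, mul_zero, zero_add, ← hρdef] at hD'
      have h3 := le_patternSum_nbrProb (b := {v // v ∉ A}) hp0 hp1 hKP hS r hD'
        (by rw [hca]; exact hm) hD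
      rw [hca, hcb, ← hρdef] at h3
      rw [one_mul]
      refine le_trans ?_ h3
      refine mul_le_of_le_one_right hL0 ?_
      have := sum_nonneg hsum
      linarith
    · rw [zero_mul]
      refine mul_nonpos_of_nonneg_of_nonpos hL0 ?_
      have h3 := exp_overlap_le (θ := 0) (fun h0 => h (overlap_eq_zero_iff.1 h0)) le_rfl
      simp only [zero_mul, Real.exp_zero, mul_one] at h3
      linarith
  refine le_trans ?_ (sum_le_sum fun S _ => prod_ringWeight_mul_le_mul (hpt S))
  have h5 := sum_prod_ringWeight_overlap_le (a := {i // i ∈ A}) hKP one_le_two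
  have h6 := overlapBound_eq {i // i ∈ A} 0 ((K : ℝ) ^ 2 / P)
  rw [hca, zero_mul, Real.exp_zero, mul_one] at h6
  rw [← h6] at h5
  refine (mul_le_mul_of_nonneg_left (sub_le_sub_left h5 1) hL0).trans (le_of_eq ?_)
  have h7 : ∀ x y z : ℝ, x * (y * (1 - z)) = x * y - y * (x * z) := fun _ _ _ => by ring
  simp only [h7, sum_sub_distrib]
  rw [← sum_mul, ← mul_sum, sum_prod_ringWeight hKP]
  ring

end Sandwich

theorem tendsto_natCast_sub_div (c : ℕ) :
    Tendsto (fun n : ℕ => ((n - c : ℕ) : ℝ) / n) atTop (nhds 1) := by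
  have h : Tendsto (fun n : ℕ => 1 - (c : ℝ) / n) atTop (nhds (1 - 0)) :=
    tendsto_const_nhds.sub (tendsto_const_div_atTop_nhds_zero_nat (c : ℝ))
  rw [sub_zero] at h
  refine h.congr' ?_
  filter_upwards [eventually_ge_atTop (c + 1)] with n hn
  have hn0 : (n : ℝ) ≠ 0 := by
    have : 0 < n := by omega
    exact_mod_cast this.ne'
  rw [Nat.cast_sub (by omega)]
  field_simp

theorem tendsto_choose_sub_div_pow (c j : ℕ) :
    Tendsto (fun n : ℕ => ((n - c).choose j : ℝ) / (n : ℝ) ^ j) atTop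
      (nhds ((j.factorial : ℝ)⁻¹)) := by
  have h1 : Tendsto (fun n : ℕ => (n : ℝ) * (n : ℝ)⁻¹) atTop (nhds 1) := by
    refine tendsto_const_nhds.congr' ?_
    filter_upwards [eventually_gt_atTop 0] with n hn
    have : (n : ℝ) ≠ 0 := by exact_mod_cast hn.ne'
    field_simp
  have h2 := (ProbabilityTheory.tendsto_choose_mul_pow_atTop j h1).comp (tendsto_sub_atTop_nat c)
  have h3 := h2.mul ((tendsto_natCast_sub_div c).pow j)
  rw [one_pow, mul_one, one_div] at h3
  refine h3.congr' ?_
  filter_upwards [eventually_gt_atTop c] with n hn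
  have h4 : ((n - c : ℕ) : ℝ) ≠ 0 := by
    have : 0 < n - c := by omega
    exact_mod_cast this.ne'
  simp only [Function.comp_apply]
  rw [div_pow, inv_pow]
  field_simp

section Asymptotics

variable {ρ : ℕ → ℝ} {r : ℕ} {l : ℝ}

theorem tendsto_pow_mul_exp_half_div (hL : Tendsto (fun n : ℕ => n * ρ n) atTop atTop)
    (hl : Tendsto (fun n : ℕ => n * Real.exp (-(n * ρ n)) * (n * ρ n) ^ r) atTop (nhds l))
    (hl0 : l ≠ 0) (s : ℕ) :
    Tendsto (fun n : ℕ => (n * ρ n) ^ s * Real.exp (n * ρ n / 2) / n) atTop (nhds 0) := by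
  have h1 : Tendsto (fun x : ℝ => x ^ (s + r) * Real.exp (-(1 / 2) * x)) atTop (nhds 0) := by
    have := tendsto_rpow_mul_exp_neg_mul_atTop_nhds_zero ((s + r : ℕ) : ℝ) (1 / 2) (by norm_num)
    simpa only [Real.rpow_natCast] using this
  have h2 := (h1.comp hL).mul (hl.inv₀ hl0)
  rw [zero_mul] at h2
  refine h2.congr' ?_
  filter_upwards [eventually_gt_atTop 0, hL.eventually_gt_atTop 0] with n hn hLn
  have hn0 : (n : ℝ) ≠ 0 := by exact_mod_cast hn.ne'
  simp only [Function.comp_apply]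
  have h3 : Real.exp (-(1 / 2) * (n * ρ n))
      = Real.exp (n * ρ n / 2) * Real.exp (-(n * ρ n)) := by
    rw [← Real.exp_add]
    ring_nf
  rw [h3]
  generalize n * ρ n = L at *
  rw [pow_add]
  have := Real.exp_pos (-L)
  field_simp

theorem tendsto_pow_div (hL : Tendsto (fun n : ℕ => n * ρ n) atTop atTop)
    (hl : Tendsto (fun n : ℕ => n * Real.exp (-(n * ρ n)) * (n * ρ n) ^ r) atTop (nhds l))
    (hl0 : l ≠ 0) (s : ℕ) :
    Tendsto (fun n : ℕ => (n * ρ n) ^ s / n) atTop (nhds 0) := by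
  refine tendsto_of_tendsto_of_tendsto_of_le_of_le' tendsto_const_nhds
    (tendsto_pow_mul_exp_half_div hL hl hl0 s) ?_ ?_
  · filter_upwards [hL.eventually_gt_atTop 0] with n hn
    positivity
  · filter_upwards [hL.eventually_gt_atTop 0] with n hn
    gcongr
    exact le_mul_of_one_le_right (by positivity) (Real.one_le_exp (by positivity))

theorem tendsto_mul_sq (hL : Tendsto (fun n : ℕ => n * ρ n) atTop atTop)
    (hl : Tendsto (fun n : ℕ => n * Real.exp (-(n * ρ n)) * (n * ρ n) ^ r) atTop (nhds l))
    (hl0 : l ≠ 0) : Tendsto (fun n : ℕ => n * ρ n ^ 2) atTop (nhds 0) := by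
  refine (tendsto_pow_div hL hl hl0 2).congr' ?_
  filter_upwards [eventually_gt_atTop 0] with n hn
  have hn0 : (n : ℝ) ≠ 0 := by exact_mod_cast hn.ne'
  field_simp

theorem tendsto_edge_zero (hL : Tendsto (fun n : ℕ => n * ρ n) atTop atTop)
    (hl : Tendsto (fun n : ℕ => n * Real.exp (-(n * ρ n)) * (n * ρ n) ^ r) atTop (nhds l))
    (hl0 : l ≠ 0) : Tendsto ρ atTop (nhds 0) := by
  refine (tendsto_pow_div hL hl hl0 1).congr' ?_
  filter_upwards [eventually_gt_atTop 0] with n hn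
  have hn0 : (n : ℝ) ≠ 0 := by exact_mod_cast hn.ne'
  field_simp

theorem tendsto_sub_mul_sq (hL : Tendsto (fun n : ℕ => n * ρ n) atTop atTop)
    (hl : Tendsto (fun n : ℕ => n * Real.exp (-(n * ρ n)) * (n * ρ n) ^ r) atTop (nhds l))
    (hl0 : l ≠ 0) (c : ℕ) :
    Tendsto (fun n : ℕ => ((n - c : ℕ) : ℝ) * ρ n ^ 2) atTop (nhds 0) := by
  refine squeeze_zero (fun n => by positivity) (fun n => ?_) (tendsto_mul_sq hL hl hl0)
  gcongr
  exact Nat.sub_le _ _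

theorem tendsto_sum_choose_mul_pow_div (hL : Tendsto (fun n : ℕ => n * ρ n) atTop atTop) (c : ℕ) :
    Tendsto (fun n : ℕ => (∑ j ∈ range (r + 1), ((n - c).choose j : ℝ) * ρ n ^ j) / (n * ρ n) ^ r)
      atTop (nhds ((r.factorial : ℝ)⁻¹)) := by
  have h1 : ∀ j ∈ range r, Tendsto (fun n : ℕ => ((n - c).choose j : ℝ) / (n : ℝ) ^ j *
      ((n * ρ n) ^ (r - j))⁻¹) atTop (nhds 0) := by
    intro j hj
    have h2 : r - j ≠ 0 := by
      have := mem_range.1 hj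
      omega
    have h3 := (tendsto_choose_sub_div_pow c j).mul
      (((tendsto_pow_atTop h2).comp hL).inv_tendsto_atTop)
    rw [mul_zero] at h3
    exact h3
  have h4 := (tendsto_finsetSum _ h1).add (tendsto_choose_sub_div_pow c r)
  rw [sum_const_zero, zero_add] at h4
  refine h4.congr' ?_
  filter_upwards [eventually_gt_atTop 0, hL.eventually_gt_atTop 0] with n hn hLn
  have hn0 : (0 : ℝ) < n := by exact_mod_cast hn
  have hρ0 : 0 < ρ n := by
    by_contra h
    exact absurd (mul_nonpos_of_nonneg_of_nonpos hn0.le (not_lt.1 h)) (not_le.2 hLn)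
  rw [sum_range_succ, add_div, sum_div]
  congr 1
  · refine sum_congr rfl fun j hj => ?_
    have hjr := mem_range.1 hj
    rw [← Nat.sub_add_cancel hjr.le, pow_add _ (r - j) j, Nat.sub_add_cancel hjr.le, mul_pow _ _ j]
    field_simp
  · rw [mul_pow]
    field_simp

theorem tendsto_singleBound (hL : Tendsto (fun n : ℕ => n * ρ n) atTop atTop)
    (hl : Tendsto (fun n : ℕ => n * Real.exp (-(n * ρ n)) * (n * ρ n) ^ r) atTop (nhds l))
    (hl0 : l ≠ 0) (m : ℕ) (E : ℝ) :
    Tendsto (fun n : ℕ => (n : ℝ) ^ m * singleBound m r E n (ρ n)) atTop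
      (nhds ((l / r.factorial) ^ m)) := by
  have h1 := (((tendsto_edge_zero hL hl hl0).const_mul (((m + m * r : ℕ) : ℝ) * m)).add
    ((tendsto_sub_mul_sq hL hl hl0 (m + m * r)).const_mul E)).rexp
  rw [mul_zero, mul_zero, add_zero, Real.exp_zero] at h1
  have h2 := ((hl.pow m).mul h1).mul ((tendsto_sum_choose_mul_pow_div (r := r) hL m).pow m)
  rw [mul_one, ← mul_pow, ← div_eq_mul_inv] at h2
  refine h2.congr' ?_
  filter_upwards [eventually_ge_atTop (m + m * r), hL.eventually_gt_atTop 0] with n hn hLn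
  rw [singleBound, Nat.sub_sub, div_pow, mul_pow, mul_pow, ← Real.exp_nat_mul, ← Real.exp_nat_mul]
  have h3 : (((n - (m + m * r) : ℕ) : ℝ)) * -(m * ρ n - E * ρ n ^ 2)
      = m * -(n * ρ n) + (((m + m * r : ℕ) : ℝ) * m * ρ n +
        E * (((n - (m + m * r) : ℕ) : ℝ) * ρ n ^ 2)) := by
    rw [Nat.cast_sub hn]
    ring
  rw [h3]
  generalize ((m + m * r : ℕ) : ℝ) * m * ρ n + E * (((n - (m + m * r) : ℕ) : ℝ) * ρ n ^ 2) = X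
  rw [Real.exp_add]
  field_simp

theorem tendsto_coarse_exponent (hL : Tendsto (fun n : ℕ => n * ρ n) atTop atTop)
    (hl : Tendsto (fun n : ℕ => n * Real.exp (-(n * ρ n)) * (n * ρ n) ^ r) atTop (nhds l))
    (hl0 : l ≠ 0) (m : ℕ) (E : ℝ) :
    Tendsto (fun n : ℕ => m * (n * ρ n) +
      ((n - m : ℕ) : ℝ) * -((1 - (n * ρ n)⁻¹) * (m * ρ n - E * ρ n ^ 2))) atTop (nhds (m : ℝ)) := by
  have h1 := (((tendsto_edge_zero hL hl hl0).const_mul ((m : ℝ) * m)).add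
    ((tendsto_natCast_sub_div m).const_mul (m : ℝ))).add
    (((hL.inv_tendsto_atTop.const_sub 1).mul (tendsto_sub_mul_sq hL hl hl0 m)).const_mul E)
  rw [mul_zero, mul_zero, mul_zero, zero_add, add_zero, mul_one] at h1
  refine h1.congr' ?_
  filter_upwards [eventually_ge_atTop m, eventually_gt_atTop 0, hL.eventually_gt_atTop 0]
    with n hn hn0 hLn
  have hn1 : (0 : ℝ) < n := by exact_mod_cast hn0
  have hρ0 : 0 < ρ n := by
    by_contra h
    exact absurd (mul_nonpos_of_nonneg_of_nonpos hn1.le (not_lt.1 h)) (not_le.2 hLn)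
  simp only [Pi.inv_apply]
  rw [Nat.cast_sub hn]
  field_simp
  ring

theorem tendsto_coarseBound (hL : Tendsto (fun n : ℕ => n * ρ n) atTop atTop)
    (hl : Tendsto (fun n : ℕ => n * Real.exp (-(n * ρ n)) * (n * ρ n) ^ r) atTop (nhds l))
    (hl0 : l ≠ 0) (m : ℕ) (E : ℝ) :
    Tendsto (fun n : ℕ => (n : ℝ) ^ m * coarseBound m r E n (ρ n)) atTop
      (nhds (l ^ m * Real.exp m)) := by
  refine ((hl.pow m).mul (tendsto_coarse_exponent hL hl hl0 m E).rexp).congr fun n => ?_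
  rw [coarseBound, Real.exp_add, ← Real.exp_nat_mul, mul_pow, mul_pow, ← Real.exp_nat_mul, mul_neg,
    Real.exp_neg, mul_comm m r, pow_mul]
  field_simp

theorem tendsto_multiBound (hL : Tendsto (fun n : ℕ => n * ρ n) atTop atTop)
    (hl : Tendsto (fun n : ℕ => n * Real.exp (-(n * ρ n)) * (n * ρ n) ^ r) atTop (nhds l))
    (hl0 : l ≠ 0) (m : ℕ) (E : ℝ) :
    Tendsto (fun n : ℕ => (n : ℝ) ^ m * multiBound m r E n (ρ n)) atTop (nhds 0) := by
  have h := ((tendsto_coarseBound hL hl hl0 m E).mul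
    ((tendsto_natCast_sub_div m).const_mul E).rexp).mul (tendsto_mul_sq hL hl hl0)
  rw [mul_zero] at h
  refine h.congr fun n => ?_
  have h1 : E * (((n - m : ℕ) : ℝ) / n) = ((n - m : ℕ) : ℝ) * (E / n) := by ring
  rw [multiBound, coarseBound, Real.exp_add, mul_pow (Real.exp _), h1, Real.exp_nat_mul (E / n)]
  ring

theorem tendsto_disjointBound (hL : Tendsto (fun n : ℕ => n * ρ n) atTop atTop)
    (hl : Tendsto (fun n : ℕ => n * Real.exp (-(n * ρ n)) * (n * ρ n) ^ r) atTop (nhds l))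
    (hl0 : l ≠ 0) (m : ℕ) (E : ℝ) :
    Tendsto (fun n : ℕ => (n : ℝ) ^ m * disjointBound m r E n (ρ n)) atTop
      (nhds ((l / r.factorial) ^ m)) := by
  have hρ := tendsto_edge_zero hL hl hl0
  have h1 := ((hρ.const_mul ((m : ℝ) * m)).sub
    ((tendsto_sub_mul_sq hL hl hl0 m).const_mul (2 * (m : ℝ) ^ 2))).rexp
  rw [mul_zero, mul_zero, sub_zero, Real.exp_zero] at h1
  have h2 := (tendsto_choose_sub_div_pow (m + m * r) r).mul (((hρ.const_mul E).const_sub 1).pow r)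
  rw [mul_zero, sub_zero, one_pow, mul_one] at h2
  have h3 := ((hl.pow m).mul h1).mul (h2.pow m)
  rw [mul_one, ← mul_pow, ← div_eq_mul_inv] at h3
  refine h3.congr' ?_
  filter_upwards [eventually_ge_atTop m, eventually_gt_atTop 0] with n hn hn0
  have hn1 : (0 : ℝ) < n := by exact_mod_cast hn0
  have h4 : ((n - m : ℕ) : ℝ) * -(m * ρ n + 2 * (m * ρ n) ^ 2)
      = m * -(n * ρ n) + (m * m * ρ n - 2 * m ^ 2 * (((n - m : ℕ) : ℝ) * ρ n ^ 2)) := by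
    rw [Nat.cast_sub hn]
    ring
  have h5 : (ρ n - E * ρ n ^ 2) ^ r = ρ n ^ r * (1 - E * ρ n) ^ r := by
    rw [← mul_pow]
    ring
  rw [disjointBound, Nat.sub_sub, ← Real.exp_nat_mul, h4, h5]
  generalize (m : ℝ) * m * ρ n - 2 * m ^ 2 * (((n - m : ℕ) : ℝ) * ρ n ^ 2) = X
  rw [Real.exp_add, Real.exp_nat_mul]
  generalize Real.exp (-(n * ρ n)) = Y
  have h6 : n * Y * (n * ρ n) ^ r * (((n - (m + m * r)).choose r : ℝ) / (n : ℝ) ^ r *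
        (1 - E * ρ n) ^ r)
      = n * (((n - (m + m * r)).choose r : ℝ) * (ρ n ^ r * (1 - E * ρ n) ^ r)) * Y := by
    rw [mul_pow]
    field_simp
  rw [mul_right_comm, ← mul_pow, h6, mul_pow, mul_pow]
  ring

end Asymptotics

theorem tendsto_overlapBound {θ κ : ℕ → ℝ} (m : ℕ)
    (h : Tendsto (fun n => Real.exp (θ n * (m * m - m : ℕ)) * κ n) atTop (nhds 0))
    (hκ : Tendsto κ atTop (nhds 0)) :
    Tendsto (fun n => overlapBound m (θ n) (κ n)) atTop (nhds 0) := by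
  have h1 := ((((h.const_mul 2).sub hκ).rexp).sub_const 1).const_mul ((m * m - m : ℕ) : ℝ)
  rw [mul_zero, sub_zero, Real.exp_zero, sub_self, mul_zero] at h1
  refine h1.congr fun n => ?_
  rw [overlapBound, sub_mul, one_mul, mul_assoc]

theorem mul_pow_le_mul_peq {q K P : ℕ} {p : ℝ} (hq : 1 ≤ q) (hKP : K ≤ P) (hqK : 2 * q ≤ K)
    (hκ : (K : ℝ) ^ 2 / P ≤ 1 / 2) (hp0 : 0 ≤ p) :
    p * ((K : ℝ) ^ 2 / P) ^ q ≤ 2 * 4 ^ q * q.factorial * peq q K P p := by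
  have h := le_psq hq hKP hqK hκ
  rw [div_le_iff₀ (by positivity)] at h
  calc p * ((K : ℝ) ^ 2 / P) ^ q ≤ p * (psq q K P * (2 * 4 ^ q * q.factorial)) := by gcongr
    _ = _ := by rw [peq]; ring

section Limits

variable {ρ : ℕ → ℝ} {r : ℕ} {l : ℝ}

theorem tendsto_mul_edge_atTop {α : ℕ → ℝ} {αstar : ℝ}
    (hρ : ∀ n : ℕ, ρ n = (Real.log n + r * Real.log (Real.log n) + α n) / n)
    (hα : Tendsto α atTop (nhds αstar)) : Tendsto (fun n : ℕ => n * ρ n) atTop atTop := by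
  have hlog : Tendsto (fun n : ℕ => Real.log n) atTop atTop :=
    Real.tendsto_log_atTop.comp tendsto_natCast_atTop_atTop
  refine tendsto_atTop_mono' _ ?_ (tendsto_atTop_add_const_right _ (αstar - 1) hlog)
  filter_upwards [eventually_gt_atTop 0, hα.eventually_const_le (sub_one_lt αstar),
    (Real.tendsto_log_atTop.comp hlog).eventually_ge_atTop 0] with n hn hαn hll
  have hn0 : (n : ℝ) ≠ 0 := by exact_mod_cast hn.ne'
  rw [hρ, mul_div_cancel₀ _ hn0]
  have : 0 ≤ (r : ℝ) * Real.log (Real.log n) := mul_nonneg (Nat.cast_nonneg _) hll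
  linarith

theorem tendsto_mul_exp_mul_pow {α : ℕ → ℝ} {αstar : ℝ}
    (hρ : ∀ n : ℕ, ρ n = (Real.log n + r * Real.log (Real.log n) + α n) / n)
    (hα : Tendsto α atTop (nhds αstar)) :
    Tendsto (fun n : ℕ => n * Real.exp (-(n * ρ n)) * (n * ρ n) ^ r) atTop
      (nhds (Real.exp (-αstar))) := by
  have hlog : Tendsto (fun n : ℕ => Real.log n) atTop atTop :=
    Real.tendsto_log_atTop.comp tendsto_natCast_atTop_atTop
  have h1 : Tendsto (fun x : ℝ => Real.log x / x) atTop (nhds 0) :=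
    Real.isLittleO_log_id_atTop.tendsto_div_nhds_zero
  have h2 := (((h1.comp hlog).const_mul (r : ℝ)).const_add 1).add (hα.div_atTop hlog)
  have h3 := hα.neg.rexp.mul (h2.pow r)
  rw [mul_zero, add_zero, add_zero, one_pow, mul_one] at h3
  refine h3.congr' ?_
  filter_upwards [eventually_gt_atTop 0, hlog.eventually_gt_atTop 0] with n hn hl
  have hn0 : (0 : ℝ) < n := by exact_mod_cast hn
  have h4 : Real.exp (-(Real.log n + r * Real.log (Real.log n) + α n))
      = (n : ℝ)⁻¹ * (Real.log n ^ r)⁻¹ * Real.exp (-α n) := by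
    rw [neg_add, neg_add, Real.exp_add, Real.exp_add, Real.exp_neg, Real.exp_log hn0,
      Real.exp_neg, Real.exp_nat_mul, Real.exp_log hl]
  rw [hρ, mul_div_cancel₀ _ hn0.ne', h4]
  have h5 : Real.log n + r * Real.log (Real.log n) + α n
      = Real.log n * (1 + r * (Real.log (Real.log n) / Real.log n) + α n / Real.log n) := by
    field_simp
  rw [h5, mul_pow]
  simp only [Function.comp_apply]
  field_simp

theorem tendsto_exp_mul_zero (hL : Tendsto (fun n : ℕ => n * ρ n) atTop atTop)
    (hl : Tendsto (fun n : ℕ => n * Real.exp (-(n * ρ n)) * (n * ρ n) ^ r) atTop (nhds l))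
    (hl0 : l ≠ 0) {K p κ : ℕ → ℝ} {q : ℕ} (hq : q ≠ 0) (hK : Tendsto K atTop atTop)
    (hp : ∀ n, p n ∈ Set.Ioc (0 : ℝ) 1) (hκ0 : ∀ n, 0 ≤ κ n) (hκ : Tendsto κ atTop (nhds 0))
    {C : ℝ} (hC : ∀ᶠ n in atTop, p n * κ n ^ q ≤ C * ρ n) {c : ℝ} (hc : 0 ≤ c) :
    Tendsto (fun n : ℕ => Real.exp (c * (n * ρ n) * p n / K n) * κ n) atTop (nhds 0) := by
  have hpow : Tendsto (fun n : ℕ => (Real.exp (c * (n * ρ n) * p n / K n) * κ n) ^ q) atTop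
      (nhds 0) := by
    have h1 := ((hκ.pow q).const_mul (Real.exp (q * c))).add
      ((tendsto_pow_mul_exp_half_div hL hl hl0 2).const_mul C)
    rw [zero_pow hq, mul_zero, mul_zero, add_zero] at h1
    refine squeeze_zero' (Eventually.of_forall fun n => by have := hκ0 n; positivity) ?_ h1
    filter_upwards [hC, hK.eventually_ge_atTop 1, hK.eventually_ge_atTop (2 * (q * c)),
      hL.eventually_ge_atTop 1, eventually_gt_atTop 0] with n hCn hK1 hK2 hL1 hn
    have hn0 : (0 : ℝ) < n := by exact_mod_cast hn
    obtain ⟨hp0, hp1⟩ := hp n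
    have hρ0 : 0 < ρ n := by
      by_contra h
      have := mul_nonpos_of_nonneg_of_nonpos hn0.le (not_lt.1 h)
      linarith
    have hκq : 0 ≤ κ n ^ q := pow_nonneg (hκ0 n) q
    have hK0 : 0 < K n := by linarith
    have hC0 : 0 ≤ C := by
      by_contra h
      have h2 : C * ρ n < 0 := mul_neg_of_neg_of_pos (not_le.1 h) hρ0
      have h3 : 0 ≤ p n * κ n ^ q := by positivity
      linarith
    rw [mul_pow, ← Real.exp_nat_mul]
    rcases le_total (p n * (n * ρ n)) 1 with h | h
    · refine le_add_of_le_of_nonneg ?_ (by positivity)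
      refine mul_le_mul_of_nonneg_right (Real.exp_le_exp.2 ?_) hκq
      refine mul_le_mul_of_nonneg_left ?_ (Nat.cast_nonneg _)
      rw [div_le_iff₀ hK0]
      calc c * (n * ρ n) * p n = c * (p n * (n * ρ n)) := by ring
        _ ≤ c * 1 := by gcongr
        _ ≤ c * K n := by gcongr
    · refine le_add_of_nonneg_of_le (by positivity) ?_
      have h2 : κ n ^ q ≤ C * (n * ρ n) ^ 2 / n := by
        calc κ n ^ q ≤ (p n * (n * ρ n)) * κ n ^ q := le_mul_of_one_le_left hκq h
          _ = (p n * κ n ^ q) * (n * ρ n) := by ring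
          _ ≤ (C * ρ n) * (n * ρ n) := by gcongr
          _ = _ := by field_simp
      have h3 : (q : ℝ) * (c * (n * ρ n) * p n / K n) ≤ n * ρ n / 2 := by
        rw [mul_div_assoc', div_le_iff₀ hK0]
        calc (q : ℝ) * (c * (n * ρ n) * p n) ≤ q * (c * (n * ρ n) * 1) := by gcongr
          _ = n * ρ n / 2 * (2 * (q * c)) := by ring
          _ ≤ _ := by gcongr
      calc _ ≤ Real.exp (n * ρ n / 2) * (C * (n * ρ n) ^ 2 / n) :=
            mul_le_mul (Real.exp_le_exp.2 h3) h2 hκq (Real.exp_pos _).le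
        _ = _ := by ring
  have hq' : (0 : ℝ) < (q : ℝ)⁻¹ := by positivity
  have h2 := hpow.rpow_const (p := (q : ℝ)⁻¹) (Or.inr hq'.le)
  rw [Real.zero_rpow hq'.ne'] at h2
  refine h2.congr fun n => Real.pow_rpow_inv_natCast ?_ hq
  have := hκ0 n
  positivity

end Limits

/-- The binomial moments of the number of vertices of degree at most `r` converge to those of a
Poisson variable. -/
theorem tendsto_sum_prob_degree_le {q r : ℕ} (hq : 1 ≤ q) {K P : ℕ → ℕ} {p : ℕ → ℝ} {l : ℝ}
    (hK1 : ∀ n, 1 ≤ K n) (hKP : ∀ n, K n ≤ P n) (hp : ∀ n, p n ∈ Set.Ioc (0 : ℝ) 1)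
    (hKinf : Tendsto (fun n => (K n : ℝ)) atTop atTop)
    (hκ : Tendsto (fun n => (K n : ℝ) ^ 2 / (P n : ℝ)) atTop (nhds 0))
    (hL : Tendsto (fun n : ℕ => n * peq q (K n) (P n) (p n)) atTop atTop)
    (hl : Tendsto (fun n : ℕ => n * Real.exp (-(n * peq q (K n) (P n) (p n))) *
      (n * peq q (K n) (P n) (p n)) ^ r) atTop (nhds l))
    (hl0 : l ≠ 0) (m : ℕ) :
    Tendsto (fun n => ∑ A ∈ powersetCard m (univ : Finset (Fin n)),
        prob n (K n) (P n) (p n) {ω | ∀ i ∈ A, degree q n (P n) ω i ≤ r}) atTop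
      (nhds ((l / r.factorial) ^ m / m.factorial)) := by
  set C : ℝ := 2 * 4 ^ q * q.factorial with hCdef
  have hC0 : 0 ≤ C := by positivity
  set ρ : ℕ → ℝ := fun n => peq q (K n) (P n) (p n) with hρ
  set κ : ℕ → ℝ := fun n => (K n : ℝ) ^ 2 / (P n : ℝ) with hκdef
  have hC : ∀ᶠ n in atTop, p n * κ n ^ q ≤ C * ρ n := by
    filter_upwards [hKinf.eventually_ge_atTop ((2 * q : ℕ) : ℝ),
      hκ.eventually_le_const (by norm_num : (0 : ℝ) < 1 / 2)] with n h1 h2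
    exact mul_pow_le_mul_peq hq (hKP n) (by exact_mod_cast h1) h2 (hp n).1.le
  have hθ : Tendsto (fun n => overlapBound m (n * (C * ρ n * p n / K n)) (κ n)) atTop (nhds 0) := by
    refine tendsto_overlapBound m ?_ hκ
    refine (tendsto_exp_mul_zero hL hl hl0 (by omega : q ≠ 0) hKinf hp
      (fun n => by positivity) hκ hC
      (by positivity : (0 : ℝ) ≤ C * (m * m - m : ℕ))).congr fun n => ?_
    congr 2
    ring
  have hθ0 : Tendsto (fun n => overlapBound m 0 (κ n)) atTop (nhds 0) :=
    tendsto_overlapBound (θ := fun _ => 0) m (by simpa using hκ) hκ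
  have hchoose : Tendsto (fun n : ℕ => (n.choose m : ℝ) / (n : ℝ) ^ m) atTop
      (nhds ((m.factorial : ℝ)⁻¹)) := tendsto_choose_sub_div_pow 0 m
  have hhi := hchoose.mul (((tendsto_singleBound hL hl hl0 m ((m * C) ^ 2)).add
    (tendsto_multiBound hL hl hl0 m ((m * C) ^ 2))).add
    ((tendsto_coarseBound hL hl hl0 m ((m * C) ^ 2)).mul hθ))
  have hlo := hchoose.mul ((tendsto_disjointBound hL hl hl0 m ((m * C) ^ 2)).mul
    (hθ0.const_sub 1))
  have hlim : (m.factorial : ℝ)⁻¹ * (l / r.factorial) ^ m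
      = (l / r.factorial) ^ m / m.factorial := by
    rw [mul_comm, ← div_eq_mul_inv]
  rw [mul_zero, add_zero, add_zero, hlim] at hhi
  rw [sub_zero, mul_one, hlim] at hlo
  have hρ0 := tendsto_edge_zero hL hl hl0
  refine tendsto_of_tendsto_of_tendsto_of_le_of_le' hlo hhi ?_ ?_
  · have e1 := (hρ0.const_mul (m : ℝ)).eventually_le_const
      (by norm_num : (m : ℝ) * 0 < 1 / 2)
    have e2 := (hρ0.const_mul ((m * C) ^ 2)).eventually_le_const
      (by norm_num : (m * C) ^ 2 * 0 < (1 : ℝ))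
    filter_upwards [e1, e2, hC, hL.eventually_gt_atTop 0, eventually_gt_atTop 0]
      with n h1 h2 h3 h4 hn
    have hn0 : (0 : ℝ) < n := by exact_mod_cast hn
    have hρn : 0 < ρ n := pos_of_mul_pos_right h4 hn0.le
    have h5 : (m * C) ^ 2 * ρ n ^ 2 ≤ ρ n := by nlinarith
    have h6 := card_nsmul_le_sum (powersetCard m (univ : Finset (Fin n))) _ _ fun A hA =>
      le_prob_degree_le_bounds hq (hK1 n) (hKP n) (hp n).1.le (hp n).2 h3 h1 h5 A
        (mem_powersetCard.1 hA).2 r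
    rw [card_powersetCard, Finset.card_univ, Fintype.card_fin, nsmul_eq_mul] at h6
    have hc : ∀ x y : ℝ, (n.choose m : ℝ) / (n : ℝ) ^ m * ((n : ℝ) ^ m * x * y)
        = n.choose m * (x * y) := fun x y => by field_simp
    exact (hc _ _).trans_le h6
  · have e1 := (tendsto_mul_sq hL hl hl0).eventually_le_const zero_lt_one
    filter_upwards [e1, hC, hL.eventually_ge_atTop 1, eventually_gt_atTop 0]
      with n h1 h3 h4 hn
    have hn0 : (0 : ℝ) < n := by exact_mod_cast hn
    have hρn : 0 < ρ n := pos_of_mul_pos_right (one_pos.trans_le h4) hn0.le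
    have h6 := sum_le_card_nsmul (powersetCard m (univ : Finset (Fin n)))
      (fun A => prob n (K n) (P n) (p n) {ω | ∀ i ∈ A, degree q n (P n) ω i ≤ r}) _ fun A hA => by
        have h7 := prob_degree_le_le_bounds hq (hK1 n) (hKP n) (hp n).1.le (hp n).2 h3 hC0 hρn h4 h1
          A r
        rw [(mem_powersetCard.1 hA).2] at h7
        exact h7
    rw [card_powersetCard, Finset.card_univ, Fintype.card_fin, nsmul_eq_mul] at h6
    have hc : ∀ x y z w : ℝ, (n.choose m : ℝ) / (n : ℝ) ^ m *
        ((n : ℝ) ^ m * x + (n : ℝ) ^ m * y + (n : ℝ) ^ m * z * w)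
        = n.choose m * (x + y + z * w) := fun x y z w => by field_simp
    exact h6.trans (hc _ _ _ _).ge

/-- if `K_n → ∞`, `K_n²/P_n → 0` and
`p_{e,q}(n) = (ln n + (k−1) ln ln n + α_n)/n` with `α_n → α* ∈ ℝ`, then
`P[min degree of 𝔾_q(n,K_n,P_n,p_n) ≥ k] → exp(−e^{−α*}/(k−1)!)`. -/
theorem min_degree_atLeast_k_prob_finite_limit
    (q : ℕ) (hq : 1 ≤ q) (k : ℕ) (hk : 1 ≤ k)
    (K P : ℕ → ℕ) (p : ℕ → ℝ) (α : ℕ → ℝ) (αstar : ℝ)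
    (hK1 : ∀ n, 1 ≤ K n) (hKP : ∀ n, K n ≤ P n)
    (hp : ∀ n, p n ∈ Set.Ioc (0 : ℝ) 1)
    (hKinf : Tendsto (fun n => (K n : ℝ)) atTop atTop)
    (hKsqP : Tendsto (fun n => ((K n : ℝ)) ^ 2 / (P n : ℝ)) atTop (nhds 0))
    (hpe : ∀ n : ℕ, peq q (K n) (P n) (p n)
      = (Real.log (n : ℝ) + ((k : ℝ) - 1) * Real.log (Real.log (n : ℝ)) + α n) / (n : ℝ))
    (hα : Tendsto α atTop (nhds αstar)) :
    Tendsto (fun n => prob n (K n) (P n) (p n) {ω | k ≤ minDeg q n (P n) ω})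
      atTop (nhds (Real.exp (-(Real.exp (-αstar) / (Nat.factorial (k - 1) : ℝ))))) := by
  obtain ⟨r, rfl⟩ : ∃ r, k = r + 1 := ⟨k - 1, by omega⟩
  simp only [Nat.cast_add, Nat.cast_one, add_sub_cancel_right] at hpe
  rw [Nat.add_sub_cancel]
  refine tendsto_exp_neg_of_binomial_moments _
    (fun m n => ∑ A ∈ powersetCard m (univ : Finset (Fin n)),
      prob n (K n) (P n) (p n) {ω | ∀ i ∈ A, degree q n (P n) ω i ≤ r}) _ (fun M => ?_)
    (tendsto_sum_prob_degree_le hq hK1 hKP hp hKinf hKsqP (tendsto_mul_edge_atTop hpe hα)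
      (tendsto_mul_exp_mul_pow hpe hα) (Real.exp_pos _).ne')
  filter_upwards [eventually_gt_atTop 0] with n hn
  exact abs_prob_minDeg_sub_le q hn (hp n).1.le (hp n).2 r M
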